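/- arXiv:2212.13687 — 3 statements merged into one kernel-verified Lean document; each statement's English description precedes it below -/
import Mathlib

section
/- Let χ be an odd Dirichlet character modulo N (N > 2) and let n ≥ 1 be an integer. Then L̃_{ℤ/Nℤ}(n, χ) = (2/n) ∑_{i=1}^{n} i · c_{n,i} · (N^{2i+1}/π^{2i+1}) · L(2i+1, χ). -/
open Finset Filter Real

/-- The sum over nonzero integers of `1/(x+j)^k`, paired. -/
noncomputable def auxG (k : ℕ) (x : ℝ) : ℝ :=
  ∑' n : ℕ, (1 / (x - ((n : ℝ) + 1)) ^ k + 1 / (x + ((n : ℝ) + 1)) ^ k)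

noncomputable def auxE (k : ℕ) (x : ℝ) : ℝ := 1 / x ^ k + auxG k x

lemma aux_hasDerivAt_inv_pow (k : ℕ) (a x : ℝ) (h : x + a ≠ 0) :
    HasDerivAt (fun y : ℝ => 1 / (y + a) ^ k) (-k * (1 / (x + a) ^ (k + 1))) x := by
  have h1 : HasDerivAt (fun y : ℝ => y + a) 1 x := (hasDerivAt_id x).add_const a
  have h2 := (h1.fun_pow k).fun_inv (pow_ne_zero k h)
  simp only [one_div]
  refine HasDerivAt.congr_deriv (h2) (Eq.symm ?_)
  rcases k with _ | k
  · simp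
  · simp only [Nat.add_sub_cancel]
    field_simp
    ring

lemma aux_bound (k : ℕ) (hk : 2 ≤ k) (r : ℝ) (hr0 : 0 ≤ r) (hr : r < 1) (n : ℕ) (z : ℝ)
    (hz : (1 - r) * ((n : ℝ) + 1) ≤ |z|) :
    ‖1 / z ^ k‖ ≤ (1 / (1 - r) ^ k) * (1 / ((n : ℝ) + 1) ^ 2) := by
  have h1 : 0 < 1 - r := by linarith
  have hn : (1 : ℝ) ≤ (n : ℝ) + 1 := by have := Nat.cast_nonneg (α := ℝ) n; linarith
  rw [norm_div, norm_one, norm_pow, Real.norm_eq_abs, one_div_mul_one_div]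
  refine one_div_le_one_div_of_le (by positivity) ?_
  calc (1 - r) ^ k * ((n : ℝ) + 1) ^ 2 ≤ (1 - r) ^ k * ((n : ℝ) + 1) ^ k :=
        mul_le_mul_of_nonneg_left (pow_le_pow_right₀ hn hk) (by positivity)
    _ = ((1 - r) * ((n : ℝ) + 1)) ^ k := (mul_pow _ _ _).symm
    _ ≤ |z| ^ k := pow_le_pow_left₀ (by positivity) hz k

lemma auxG_hasDerivAt (k : ℕ) (hk : 1 ≤ k) (x : ℝ) (hx : |x| < 1) :
    HasDerivAt (auxG k) (-k * auxG (k + 1) x) x := by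
  obtain ⟨r, hxr, hr⟩ := exists_between hx
  have hr0 : 0 ≤ r := (abs_nonneg x).trans hxr.le
  have key : ∀ (n : ℕ) (y : ℝ), y ∈ Metric.ball (0 : ℝ) r →
      (1 - r) * ((n : ℝ) + 1) ≤ |y - ((n : ℝ) + 1)| ∧
      (1 - r) * ((n : ℝ) + 1) ≤ |y + ((n : ℝ) + 1)| := by
    intro n y hy
    rw [mem_ball_zero_iff, Real.norm_eq_abs, abs_lt] at hy
    have := Nat.cast_nonneg (α := ℝ) n
    have h3 : 0 ≤ r * n := by positivity
    constructor
    · rw [le_abs]; right; nlinarith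
    · rw [le_abs]; left; nlinarith
  have key0 : ∀ (n : ℕ) (y : ℝ), y ∈ Metric.ball (0 : ℝ) r →
      y - ((n : ℝ) + 1) ≠ 0 ∧ y + ((n : ℝ) + 1) ≠ 0 := by
    intro n y hy
    have h := key n y hy
    have : 0 < (1 - r) * ((n : ℝ) + 1) := mul_pos (by linarith) (by positivity)
    exact ⟨abs_pos.1 (this.trans_le h.1), abs_pos.1 (this.trans_le h.2)⟩
  have hs : Summable fun n : ℕ => 1 / ((n : ℝ) + 1) ^ 2 := by
    have := (summable_nat_add_iff 1).2 (Real.summable_one_div_nat_pow.2 one_lt_two)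
    simpa using this
  have h := hasDerivAt_tsum_of_isPreconnected (𝕜 := ℝ)
    (u := fun n : ℕ => (k * (2 * (1 / (1 - r) ^ (k + 1)))) * (1 / ((n : ℝ) + 1) ^ 2))
    (g := fun (n : ℕ) (y : ℝ) => 1 / (y - ((n : ℝ) + 1)) ^ k + 1 / (y + ((n : ℝ) + 1)) ^ k)
    (g' := fun (n : ℕ) (y : ℝ) => -k * (1 / (y - ((n : ℝ) + 1)) ^ (k + 1)
      + 1 / (y + ((n : ℝ) + 1)) ^ (k + 1)))
    (t := Metric.ball (0 : ℝ) r) (y₀ := 0) (y := x) (hs.mul_left _) Metric.isOpen_ball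
    (convex_ball 0 r).isPreconnected ?_ ?_ ?_ ?_ ?_
  · rw [tsum_mul_left] at h
    exact h
  · intro n y hy
    have h1 := aux_hasDerivAt_inv_pow k (-((n : ℝ) + 1)) y (by simpa [sub_eq_add_neg] using (key0 n y hy).1)
    have h2 := aux_hasDerivAt_inv_pow k ((n : ℝ) + 1) y (key0 n y hy).2
    simp only [← sub_eq_add_neg] at h1
    refine HasDerivAt.congr_deriv (h1.fun_add h2) (Eq.symm ?_)
    ring
  · intro n y hy
    have b1 := aux_bound (k + 1) (by omega) r hr0 hr n _ (key n y hy).1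
    have b2 := aux_bound (k + 1) (by omega) r hr0 hr n _ (key n y hy).2
    rw [norm_mul, norm_neg, Real.norm_natCast, mul_assoc]
    refine mul_le_mul_of_nonneg_left ((norm_add_le _ _).trans ?_) (Nat.cast_nonneg _)
    linarith
  · exact Metric.mem_ball_self ((abs_nonneg x).trans_lt hxr)
  · rcases Nat.lt_or_ge 1 k with h1 | h1
    · have h0 : (0 : ℝ) ∈ Metric.ball (0 : ℝ) r :=
        Metric.mem_ball_self ((abs_nonneg x).trans_lt hxr)
      refine Summable.of_norm_bounded (hs.mul_left (2 * (1 / (1 - r) ^ k))) fun n => ?_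
      have b1 := aux_bound k h1 r hr0 hr n _ (key n 0 h0).1
      have b2 := aux_bound k h1 r hr0 hr n _ (key n 0 h0).2
      refine (norm_add_le _ _).trans ?_
      linarith
    · obtain rfl : k = 1 := by omega
      refine summable_zero.congr fun n => ?_
      have : (n : ℝ) + 1 ≠ 0 := by positivity
      rw [zero_sub, zero_add, pow_one, pow_one, div_neg]; ring
  · rwa [mem_ball_zero_iff]

lemma auxE_hasDerivAt (k : ℕ) (hk : 1 ≤ k) (x : ℝ) (hx : |x| < 1) (h0 : x ≠ 0) :
    HasDerivAt (auxE k) (-k * auxE (k + 1) x) x := by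
  have h1 := aux_hasDerivAt_inv_pow k 0 x (by simpa using h0)
  simp only [add_zero] at h1
  refine HasDerivAt.congr_deriv (h1.fun_add (auxG_hasDerivAt k hk x hx)) (Eq.symm ?_)
  rw [auxE]; ring

lemma auxE_one (x : ℝ) (hx : 0 < x) (hx1 : x < 1) : auxE 1 x = π * Real.cot (π * x) := by
  have hz : (x : ℂ) ∈ Complex.integerComplement := by
    rw [Complex.mem_integerComplement_iff]
    rintro ⟨n, hn⟩
    have hn' : (n : ℝ) = x := by exact_mod_cast hn
    have h1 : (0 : ℝ) < n := by linarith
    have h2 : (n : ℝ) < 1 := by linarith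
    norm_cast at h1 h2
    omega
  have h := cot_series_rep' hz
  have h2 : ((π * Real.cot (π * x) - 1 / x : ℝ) : ℂ) = (auxG 1 x : ℝ) := by
    rw [auxG]
    push_cast
    rw [h]
    simp
  have h3 := Complex.ofReal_injective h2
  rw [auxE, ← h3]
  simp

lemma auxE_two (x : ℝ) (hx : 0 < x) (hx1 : x < 1) :
    auxE 2 x = π ^ 2 * (1 / Real.sin (π * x) ^ 2) := by
  have hs : Real.sin (π * x) ≠ 0 :=
    (Real.sin_pos_of_pos_of_lt_pi (by positivity) (by nlinarith [Real.pi_pos])).ne'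
  have h1 := auxE_hasDerivAt 1 le_rfl x (by rw [abs_lt]; constructor <;> linarith) hx.ne'
  have hl : HasDerivAt (fun y : ℝ => π * y) π x := by
    simpa using (hasDerivAt_id x).const_mul π
  have h2 : HasDerivAt (fun y => π * Real.cot (π * y)) (-(π ^ 2 * (1 / Real.sin (π * x) ^ 2))) x := by
    simp only [Real.cot_eq_cos_div_sin]
    have := (((Real.hasDerivAt_cos _).comp x hl).fun_div ((Real.hasDerivAt_sin _).comp x hl) hs).const_mul π
    refine HasDerivAt.congr_deriv (this) (Eq.symm ?_)
    simp only [Function.comp]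
    field_simp
    linarith [Real.sin_sq_add_cos_sq (π * x)]
  have h3 : auxE 1 =ᶠ[nhds x] fun y => π * Real.cot (π * y) := by
    filter_upwards [Ioo_mem_nhds hx hx1] with y hy using auxE_one y hy.1 hy.2
  have := h1.unique (h2.congr_of_eventuallyEq h3)
  push_cast at this
  linarith

lemma aux_f_deriv (n : ℕ) (x : ℝ) (hs : Real.sin (π * x) ≠ 0) :
    HasDerivAt (fun y => 1 / Real.sin (π * y) ^ (2 * n))
      (-(2 * n * π) * (Real.cos (π * x) / Real.sin (π * x) ^ (2 * n + 1))) x := by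
  have hl : HasDerivAt (fun y : ℝ => π * y) π x := by
    simpa using (hasDerivAt_id x).const_mul π
  have h1 : HasDerivAt (fun y : ℝ => Real.sin (π * y)) (Real.cos (π * x) * π) x :=
    (Real.hasDerivAt_sin _).comp x hl
  have h2 := (h1.fun_pow (2 * n)).fun_inv (pow_ne_zero _ hs)
  simp only [one_div]
  refine HasDerivAt.congr_deriv (h2) (Eq.symm ?_)
  rcases n with _ | n
  · simp
  · simp only [show 2 * (n + 1) - 1 = 2 * n + 1 by omega]
    push_cast
    field_simp
    ring

lemma aux_f_deriv2 (n : ℕ) (x : ℝ) (hs : Real.sin (π * x) ≠ 0) :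
    HasDerivAt (fun x => -(2 * n * π) * (Real.cos (π * x) / Real.sin (π * x) ^ (2 * n + 1)))
      (π ^ 2 * (2 * n * (2 * n + 1) * (1 / Real.sin (π * x) ^ (2 * (n + 1)))
        - 4 * n ^ 2 * (1 / Real.sin (π * x) ^ (2 * n)))) x := by
  have hl : HasDerivAt (fun y : ℝ => π * y) π x := by
    simpa using (hasDerivAt_id x).const_mul π
  have h1 : HasDerivAt (fun y : ℝ => Real.sin (π * y)) (Real.cos (π * x) * π) x :=
    (Real.hasDerivAt_sin _).comp x hl
  have h3 : HasDerivAt (fun y : ℝ => Real.cos (π * y)) (-Real.sin (π * x) * π) x :=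
    (Real.hasDerivAt_cos _).comp x hl
  have h2 := (h3.fun_div (h1.fun_pow (2 * n + 1)) (pow_ne_zero _ hs)).const_mul (-(2 * n * π))
  refine HasDerivAt.congr_deriv (h2) (Eq.symm ?_)
  simp only [Nat.add_sub_cancel]
  push_cast
  have hc : Real.cos (π * x) ^ 2 = 1 - Real.sin (π * x) ^ 2 := by
    linarith [Real.sin_sq_add_cos_sq (π * x)]
  generalize Real.sin (π * x) = s at *
  generalize Real.cos (π * x) = c at *
  have e : ∀ A : ℝ, -(s) * π * s ^ (2 * n + 1) - c * ((2 * n + 1) * s ^ (2 * n) * (c * π)) =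
    -(π * s ^ (2 * n) * (s ^ 2 + (2 * n + 1) * c ^ 2)) := by intro _; ring
  rw [e 0, hc]
  field_simp
  ring

lemma aux_exists (n : ℕ) : ∃ a : ℕ → ℝ, ∀ x : ℝ, 0 < x → x < 1 →
    1 / Real.sin (π * x) ^ (2 * (n + 1)) = ∑ i ∈ range (n + 1), a i * auxE (2 * i + 2) x := by
  induction n with
  | zero =>
    refine ⟨fun _ => 1 / π ^ 2, fun x hx hx1 => ?_⟩
    have := auxE_two x hx hx1
    simp only [zero_add, range_one, sum_singleton, mul_zero, mul_one]
    rw [this]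
    have := Real.pi_ne_zero
    field_simp
  | succ n ih =>
    obtain ⟨a, ha⟩ := ih
    set m : ℝ := ((n + 1 : ℕ) : ℝ) with hm
    have hm0 : 0 < m := by rw [hm]; positivity
    refine ⟨fun i => (4 * m ^ 2 * (if i < n + 1 then a i else 0) +
      (if i = 0 then 0 else (2 * i) * (2 * i + 1) * a (i - 1)) / π ^ 2) / (2 * m * (2 * m + 1)),
      fun x hx hx1 => ?_⟩
    have hsin : ∀ y, 0 < y → y < 1 → Real.sin (π * y) ≠ 0 := fun y hy hy1 =>
      (Real.sin_pos_of_pos_of_lt_pi (by positivity) (by nlinarith [Real.pi_pos])).ne'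
    have hd1 : ∀ y, 0 < y → y < 1 →
      -(2 * m * π) * (Real.cos (π * y) / Real.sin (π * y) ^ (2 * (n + 1) + 1)) =
        ∑ i ∈ range (n + 1), a i * (-(2 * i + 2 : ℕ) * auxE (2 * i + 3) y) := by
      intro y hy hy1
      have h1 := aux_f_deriv (n + 1) y (hsin y hy hy1)
      have h2 : HasDerivAt (fun y => ∑ i ∈ range (n + 1), a i * auxE (2 * i + 2) y)
        (∑ i ∈ range (n + 1), a i * (-(2 * i + 2 : ℕ) * auxE (2 * i + 3) y)) y :=
        HasDerivAt.fun_sum fun i _ => (auxE_hasDerivAt (2 * i + 2) (by omega) y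
          (by rw [abs_lt]; constructor <;> linarith) hy.ne').const_mul _
      refine h1.unique (h2.congr_of_eventuallyEq ?_)
      filter_upwards [Ioo_mem_nhds hy hy1] with z hz using ha z hz.1 hz.2
    have hd2 : π ^ 2 * (2 * m * (2 * m + 1) * (1 / Real.sin (π * x) ^ (2 * (n + 1 + 1)))
        - 4 * m ^ 2 * (1 / Real.sin (π * x) ^ (2 * (n + 1)))) =
        ∑ i ∈ range (n + 1), a i * (-(2 * i + 2 : ℕ) * (-(2 * i + 3 : ℕ) * auxE (2 * i + 4) x)) := by
      have h1 := aux_f_deriv2 (n + 1) x (hsin x hx hx1)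
      have h2 : HasDerivAt (fun y => ∑ i ∈ range (n + 1), a i * (-(2 * i + 2 : ℕ) * auxE (2 * i + 3) y))
        (∑ i ∈ range (n + 1), a i * (-(2 * i + 2 : ℕ) * (-(2 * i + 3 : ℕ) * auxE (2 * i + 4) x))) x :=
        HasDerivAt.fun_sum fun i _ => ((auxE_hasDerivAt (2 * i + 3) (by omega) x
          (by rw [abs_lt]; constructor <;> linarith) hx.ne').const_mul _).const_mul _
      refine h1.unique (h2.congr_of_eventuallyEq ?_)
      filter_upwards [Ioo_mem_nhds hx hx1] with z hz using hd1 z hz.1 hz.2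
    have hsum : ∑ i ∈ range (n + 1 + 1), ((4 * m ^ 2 * (if i < n + 1 then a i else 0) +
      (if i = 0 then 0 else (2 * i) * (2 * i + 1) * a (i - 1)) / π ^ 2) / (2 * m * (2 * m + 1))) *
        auxE (2 * i + 2) x = (4 * m ^ 2 * (∑ i ∈ range (n + 1), a i * auxE (2 * i + 2) x) +
        (∑ i ∈ range (n + 1), a i * (-(2 * i + 2 : ℕ) * (-(2 * i + 3 : ℕ) * auxE (2 * i + 4) x))) / π ^ 2)
          / (2 * m * (2 * m + 1)) := by
      have e1 : ∑ i ∈ range (n + 1), a i * auxE (2 * i + 2) x =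
          ∑ i ∈ range (n + 1 + 1), (if i < n + 1 then a i else 0) * auxE (2 * i + 2) x := by
        rw [sum_range_succ _ (n + 1)]
        simp only [lt_irrefl, if_false, zero_mul, add_zero]
        refine sum_congr rfl fun i hi => ?_
        rw [if_pos (mem_range.1 hi)]
      have e2 : ∑ i ∈ range (n + 1), a i * (-(2 * i + 2 : ℕ) * (-(2 * i + 3 : ℕ) * auxE (2 * i + 4) x)) =
          ∑ i ∈ range (n + 1 + 1), (if i = 0 then 0 else (2 * i) * (2 * i + 1) * a (i - 1)) *
            auxE (2 * i + 2) x := by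
        rw [sum_range_succ' _ (n + 1)]
        simp only [if_true, zero_mul, add_zero]
        refine sum_congr rfl fun i hi => ?_
        rw [if_neg (by omega)]
        simp only [Nat.add_sub_cancel, show 2 * (i + 1) + 2 = 2 * i + 4 by ring]
        push_cast
        ring
      rw [e1, e2, mul_sum, sum_div, ← sum_add_distrib, sum_div]
      refine sum_congr rfl fun i _ => ?_
      ring
    rw [hsum, ← hd2, ← ha x hx hx1]
    have := Real.pi_ne_zero
    have h5 : 2 * m * (2 * m + 1) ≠ 0 := by positivity
    rw [mul_div_cancel_left₀ _ (pow_ne_zero 2 this)]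
    rw [add_sub_cancel, mul_div_cancel_left₀ _ h5]

lemma aux_unique (n : ℕ) (b : ℕ → ℝ) (L : ℝ)
    (h : Tendsto (fun x : ℝ => ∑ s ∈ range n, b s / x ^ (2 * s + 2)) (nhdsWithin 0 (Set.Ioi 0))
      (nhds L)) : ∀ s < n, b s = 0 := by
  induction n with
  | zero => intro s hs; omega
  | succ n ih =>
    have hx : Tendsto (fun x : ℝ => x) (nhdsWithin 0 (Set.Ioi 0)) (nhds 0) := nhdsWithin_le_nhds
    have h1 : Tendsto (fun x : ℝ => x ^ (2 * n + 2) * ∑ s ∈ range (n + 1), b s / x ^ (2 * s + 2))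
      (nhdsWithin 0 (Set.Ioi 0)) (nhds 0) := by
      have := (hx.pow (2 * n + 2)).mul h
      simpa using this
    have h2 : Tendsto (fun x : ℝ => x ^ (2 * n + 2) * ∑ s ∈ range (n + 1), b s / x ^ (2 * s + 2))
      (nhdsWithin 0 (Set.Ioi 0)) (nhds (b n)) := by
      have h3 : Tendsto (fun x : ℝ => (∑ s ∈ range n, b s * x ^ (2 * (n - s))) + b n)
          (nhdsWithin 0 (Set.Ioi 0)) (nhds ((∑ s ∈ range n, b s * 0) + b n)) := by
        refine (tendsto_finsetSum _ fun s hs => ?_).add_const _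
        have h4 := hx.pow (2 * (n - s))
        rw [zero_pow (by have := mem_range.1 hs; omega)] at h4
        exact h4.const_mul _
      simp only [mul_zero, sum_const_zero, zero_add] at h3
      refine h3.congr' ?_
      filter_upwards [self_mem_nhdsWithin] with x hx
      have hx0 : x ≠ 0 := ne_of_gt hx
      rw [sum_range_succ, mul_add, mul_sum]
      congr 1
      · refine sum_congr rfl fun s hs => ?_
        have := mem_range.1 hs
        rw [show 2 * n + 2 = 2 * (n - s) + (2 * s + 2) by omega, pow_add]
        field_simp
      · field_simp
    have hb : b n = 0 := tendsto_nhds_unique h2 h1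
    have h' : ∀ s < n, b s = 0 := by
      apply ih
      simpa [sum_range_succ, hb] using h
    intro s hs
    rcases Nat.lt_succ_iff_lt_or_eq.1 hs with h3 | rfl
    · exact h' s h3
    · exact hb

lemma aux_coeff (n : ℕ) (c : ℕ → ℝ)
    (hc : Filter.Tendsto
        (fun x : ℝ => 1 / Real.sin x ^ (2 * (n + 1)) -
          ∑ s ∈ Finset.range (n + 1 + 1), c s / x ^ (2 * s))
        (nhdsWithin 0 {0}ᶜ) (nhds 0)) (a : ℕ → ℝ)
    (ha : ∀ x : ℝ, 0 < x → x < 1 →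
    1 / Real.sin (π * x) ^ (2 * (n + 1)) = ∑ i ∈ range (n + 1), a i * auxE (2 * i + 2) x) :
    ∀ i < n + 1, a i = c (i + 1) / π ^ (2 * i + 2) := by
  have hpi := Real.pi_pos
  have hl : Tendsto (fun x : ℝ => π * x) (nhdsWithin 0 (Set.Ioi 0)) (nhdsWithin 0 {0}ᶜ) := by
    refine tendsto_nhdsWithin_iff.2 ⟨?_, ?_⟩
    · have : Tendsto (fun x : ℝ => π * x) (nhds 0) (nhds (π * 0)) :=
        (continuous_const.mul continuous_id).tendsto 0
      rw [mul_zero] at this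
      exact this.mono_left nhdsWithin_le_nhds
    · filter_upwards [self_mem_nhdsWithin] with x hx
      exact (mul_pos hpi hx).ne'
  have h1 := hc.comp hl
  have h2 : Tendsto (fun x : ℝ => ∑ i ∈ range (n + 1), a i * auxG (2 * i + 2) x)
      (nhdsWithin 0 (Set.Ioi 0)) (nhds (∑ i ∈ range (n + 1), a i * auxG (2 * i + 2) 0)) := by
    refine tendsto_finsetSum _ fun i _ => Tendsto.const_mul _ ?_
    exact (auxG_hasDerivAt (2 * i + 2) (by omega) 0 (by simp)).continuousAt.tendsto.mono_left
      nhdsWithin_le_nhds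
  have h3 := (h1.sub h2).add_const (c 0)
  have h4 := aux_unique (n + 1) (fun i => a i - c (i + 1) / π ^ (2 * i + 2)) _ (h3.congr' ?_)
  · intro i hi
    exact sub_eq_zero.1 (h4 i hi)
  · filter_upwards [Ioo_mem_nhdsGT (zero_lt_one (α := ℝ))] with x hx
    simp only [Function.comp]
    rw [ha x hx.1 hx.2, sum_range_succ' _ (n + 1)]
    simp only [mul_zero, pow_zero, div_one, auxE, mul_add, sum_add_distrib, mul_one]
    simp only [sub_div, sum_sub_distrib, mul_pow, div_div, mul_one_div]
    ring

lemma aux_cot (n : ℕ) (c : ℕ → ℝ)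
    (hc : Filter.Tendsto
        (fun x : ℝ => 1 / Real.sin x ^ (2 * (n + 1)) -
          ∑ s ∈ Finset.range (n + 1 + 1), c s / x ^ (2 * s))
        (nhdsWithin 0 {0}ᶜ) (nhds 0)) (x : ℝ) (hx : 0 < x) (hx1 : x < 1) :
    Real.cot (π * x) / Real.sin (π * x) ^ (2 * (n + 1)) = 1 / (n + 1 : ℕ) *
      ∑ i ∈ Icc 1 (n + 1), i * c i * (1 / π ^ (2 * i + 1)) * auxE (2 * i + 1) x := by
  obtain ⟨a, ha⟩ := aux_exists n
  have hac := aux_coeff n c hc a ha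
  have hs : Real.sin (π * x) ≠ 0 :=
    (Real.sin_pos_of_pos_of_lt_pi (by positivity) (by nlinarith [Real.pi_pos])).ne'
  have h1 := aux_f_deriv (n + 1) x hs
  have h2 : HasDerivAt (fun y => ∑ i ∈ range (n + 1), a i * auxE (2 * i + 2) y)
        (∑ i ∈ range (n + 1), a i * (-(2 * i + 2 : ℕ) * auxE (2 * i + 3) x)) x :=
        HasDerivAt.fun_sum fun i _ => (auxE_hasDerivAt (2 * i + 2) (by omega) x
          (by rw [abs_lt]; constructor <;> linarith) hx.ne').const_mul _
  have h3 := h1.unique (h2.congr_of_eventuallyEq (by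
      filter_upwards [Ioo_mem_nhds hx hx1] with z hz using ha z hz.1 hz.2))
  have hn : ((n + 1 : ℕ) : ℝ) ≠ 0 := by positivity
  have hpi := Real.pi_ne_zero
  have h4 : Real.cot (π * x) / Real.sin (π * x) ^ (2 * (n + 1)) =
      1 / (n + 1 : ℕ) * (-(1 / (2 * π)) * (-(2 * (n + 1 : ℕ) * π) *
        (Real.cos (π * x) / Real.sin (π * x) ^ (2 * (n + 1) + 1)))) := by
    rw [Real.cot_eq_cos_div_sin]
    field_simp
    ring
  rw [h4, h3]
  congr 1
  rw [← Finset.Ico_succ_right_eq_Icc, Finset.sum_Ico_eq_sum_range, mul_sum]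
  refine sum_congr (by simp) fun i hi => ?_
  rw [hac i (by simpa using hi), show 2 * (1 + i) + 1 = 2 * i + 3 by ring, add_comm 1 i]
  push_cast
  field_simp
  ring

lemma aux_hurwitz (i : ℕ) (hi : 1 ≤ i) (x : ℝ) (hx : 0 < x) (hx1 : x < 1) :
    (auxE (2 * i + 1) x : ℂ) = 2 * HurwitzZeta.hurwitzZetaOdd (x : UnitAddCircle)
      ((2 * i + 1 : ℕ) : ℂ) := by
  set k := 2 * i + 1 with hk
  have hk1 : 1 < ((k : ℕ) : ℂ).re := by
    rw [Complex.natCast_re]; exact_mod_cast (by omega : 1 < k)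
  have h1 := (HurwitzZeta.hasSum_nat_hurwitzZetaOdd_of_mem_Icc ⟨hx.le, hx1.le⟩ hk1).mul_left 2
  have h2 : HasSum (fun n : ℕ => 1 / ((n : ℝ) + x) ^ k - 1 / ((n : ℝ) + 1 - x) ^ k) (auxE k x) := by
    have hs : ∀ y : ℝ, Summable fun n : ℕ => 1 / ((n : ℝ) + y) ^ k := fun y => by
      have := Real.summable_one_div_nat_add_rpow y k
      have h3 := (this.2 (by exact_mod_cast (by omega : 1 < k)))
      simp only [Real.rpow_natCast] at h3
      refine Summable.of_norm (h3.norm.congr fun n => ?_)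
      simp
    have hA := hs x
    have hB : Summable fun n : ℕ => 1 / ((n : ℝ) + 1 - x) ^ k := by
      refine (hs (1 - x)).congr fun n => ?_
      rw [add_sub_assoc]
    refine (hA.sub hB).hasSum_iff.2 ?_
    have hA1 := (summable_nat_add_iff 1).2 hA
    rw [hA.tsum_sub hB, hA.tsum_eq_zero_add, auxE, auxG, add_sub_assoc, ← hA1.tsum_sub hB]
    congr 1
    · simp
    · refine tsum_congr fun n => ?_
      have : (x - ((n : ℝ) + 1)) ^ k = -((n : ℝ) + 1 - x) ^ k := by
        rw [← Odd.neg_pow ⟨i, hk⟩, neg_sub]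
      rw [this, div_neg]
      push_cast
      rw [add_comm x]
      ring
  have h3 := Complex.hasSum_ofReal.2 h2
  refine h3.unique ?_
  refine h1.congr_fun fun n => ?_
  push_cast
  simp only [Complex.cpow_natCast]
  ring

lemma aux_L (N : ℕ) [NeZero N] (hN : 2 < N) (χ : DirichletCharacter ℂ N) (hodd : χ (-1) = -1)
    (i : ℕ) (hi : 1 ≤ i) :
    ∑ m ∈ Finset.Icc 1 (N - 1), χ (m : ZMod N) * (auxE (2 * i + 1) ((m : ℝ) / N) : ℂ) =
      2 * (N : ℂ) ^ (2 * i + 1) * DirichletCharacter.LFunction χ ((2 * i + 1 : ℕ) : ℂ) := by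
  have hN0 : (N : ℂ) ≠ 0 := by exact_mod_cast (by omega : N ≠ 0)
  have ho : Function.Odd χ := fun x => by
    rw [← neg_one_mul, map_mul, hodd, neg_one_mul]
  rw [DirichletCharacter.LFunction, ZMod.LFunction_def_odd ho, Complex.cpow_neg,
    Complex.cpow_natCast, ← mul_assoc, mul_assoc 2, mul_inv_cancel₀ (pow_ne_zero _ hN0), mul_one,
    mul_sum]
  have h0 : (2 : ℂ) * (χ 0 * HurwitzZeta.hurwitzZetaOdd (ZMod.toAddCircle (0 : ZMod N))
      ((2 * i + 1 : ℕ) : ℂ)) = 0 := by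
    have : Fact (1 < N) := ⟨by omega⟩
    rw [MulChar.map_zero]; simp
  rw [← Finset.sum_erase (s := Finset.univ) (a := (0 : ZMod N)) h0]
  refine Finset.sum_bij (fun m _ => (m : ZMod N)) ?_ ?_ ?_ ?_
  · intro m hm
    rw [Finset.mem_Icc] at hm
    simp only [Finset.mem_erase, Finset.mem_univ, and_true]
    rw [Ne, ZMod.natCast_eq_zero_iff]
    exact Nat.not_dvd_of_pos_of_lt (by omega) (by omega)
  · intro m hm m' hm' h
    rw [Finset.mem_Icc] at hm hm'
    rw [ZMod.natCast_eq_natCast_iff'] at h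
    rwa [Nat.mod_eq_of_lt (by omega), Nat.mod_eq_of_lt (by omega)] at h
  · intro j hj
    simp only [Finset.mem_erase, Finset.mem_univ, and_true] at hj
    refine ⟨j.val, ?_, ZMod.natCast_zmod_val j⟩
    rw [Finset.mem_Icc]
    have := ZMod.val_lt j
    have := (ZMod.val_ne_zero j).2 hj
    omega
  · intro m hm
    rw [Finset.mem_Icc] at hm
    have hNr : (0 : ℝ) < N := by exact_mod_cast (by omega : 0 < N)
    have hm0 : (0 : ℝ) < m := by exact_mod_cast (by omega : 0 < m)
    have hmN : (m : ℝ) < N := by exact_mod_cast (by omega : m < N)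
    rw [aux_hurwitz i hi _ (div_pos hm0 hNr) ((div_lt_one hNr).2 hmN), ZMod.toAddCircle_apply,
      ZMod.val_natCast, Nat.mod_eq_of_lt (by omega)]
    ring

/-- Let `c g s` be the coefficient of `x^{-2s}` in the Laurent expansion of `(sin x)^{-2g}` at
`0`.  For an odd Dirichlet character `χ` mod `N` (`N > 2`) and `n ≥ 1`,
`L̃_{ℤ/Nℤ}(n,χ) = (2/n) ∑_{i=1}^{n} i c_{n,i} (N^{2i+1}/π^{2i+1}) L(2i+1,χ)`, where
`L̃_{ℤ/Nℤ}(n,χ) = ∑_{m=1}^{N-1} χ(m) cot(mπ/N)/sin^{2n}(mπ/N)`. -/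
theorem twisted_graph_LFunction_eq_LFunction_sum (c : ℕ → ℕ → ℝ)
    (hc : ∀ g : ℕ, 1 ≤ g →
      Filter.Tendsto
        (fun x : ℝ => 1 / Real.sin x ^ (2 * g) - ∑ s ∈ Finset.range (g + 1), c g s / x ^ (2 * s))
        (nhdsWithin 0 {0}ᶜ) (nhds 0))
    (N : ℕ) [NeZero N] (hN : 2 < N) (χ : DirichletCharacter ℂ N) (hodd : χ (-1) = -1)
    (n : ℕ) (hn : 1 ≤ n) :
    ∑ m ∈ Finset.Icc 1 (N - 1),
        χ (m : ZMod N) * ((Real.cot ((m : ℝ) * π / N) : ℂ)) /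
          ((Real.sin ((m : ℝ) * π / N) : ℂ)) ^ (2 * n) =
      (2 / (n : ℂ)) * ∑ i ∈ Finset.Icc 1 n, (i : ℂ) * (c n i : ℂ) *
        ((N : ℂ) ^ (2 * i + 1) / (π : ℂ) ^ (2 * i + 1)) *
        DirichletCharacter.LFunction χ ((2 * i + 1 : ℕ) : ℂ) := by
  obtain ⟨n, rfl⟩ : ∃ k, n = k + 1 := ⟨n - 1, by omega⟩
  have hNr : (0 : ℝ) < N := by exact_mod_cast (by omega : 0 < N)
  have h1 : ∀ m ∈ Finset.Icc 1 (N - 1),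
      χ (m : ZMod N) * ((Real.cot ((m : ℝ) * π / N) : ℂ)) /
          ((Real.sin ((m : ℝ) * π / N) : ℂ)) ^ (2 * (n + 1)) =
      ∑ i ∈ Finset.Icc 1 (n + 1), (1 / ((n + 1 : ℕ) : ℂ) * ((i : ℂ) * (c (n + 1) i : ℂ) *
        (1 / (π : ℂ) ^ (2 * i + 1)))) *
          (χ (m : ZMod N) * (auxE (2 * i + 1) ((m : ℝ) / N) : ℂ)) := by
    intro m hm
    rw [Finset.mem_Icc] at hm
    have hm0 : (0 : ℝ) < m := by exact_mod_cast (by omega : 0 < m)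
    have hmN : (m : ℝ) < N := by exact_mod_cast (by omega : m < N)
    have h := aux_cot n (c (n + 1)) (hc (n + 1) hn) ((m : ℝ) / N) (div_pos hm0 hNr)
      ((div_lt_one hNr).2 hmN)
    rw [show π * ((m : ℝ) / N) = (m : ℝ) * π / N by ring] at h
    have h' := congrArg (fun r : ℝ => (r : ℂ)) h
    simp only [Complex.ofReal_div, Complex.ofReal_pow, Complex.ofReal_mul, Complex.ofReal_sum,
      Complex.ofReal_one, Complex.ofReal_natCast] at h'
    rw [mul_div_assoc]
    rw [h', Finset.mul_sum, Finset.mul_sum]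
    refine Finset.sum_congr rfl fun i _ => ?_
    ring
  rw [Finset.sum_congr rfl h1, Finset.sum_comm, Finset.mul_sum]
  refine Finset.sum_congr rfl fun i hi => ?_
  rw [← Finset.mul_sum, aux_L N hN χ hodd i (Finset.mem_Icc.1 hi).1]
  ring
end

section
/- Let χ be an even primitive Dirichlet character modulo N (N > 2) and let n ≥ 1 be an integer. Then L_{ℤ/Nℤ}(n, χ) = ∑_{j=1}^{N} (χ̄(j)/G(χ̄)) · ∑_{i=1}^{n} ((−1)^{i−1} 2^{2i} B_{2i}(j/N) / (2i)!) · c_{n,i} · N^{2i}, where χ̄ is the complex conjugate character, G(χ̄) = ∑_{a=1}^{N} χ̄(a) e^{2πi a/N} is the Gauss sum, and B_k(x) is the k-th Bernoulli polynomial. -/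
open Finset Filter Real

lemma gl_sin_ne {z : ℂ} (hz : 0 < z.im) : Complex.sin (π * z) ≠ 0 :=
  sin_pi_mul_ne_zero (UpperHalfPlane.coe_mem_integerComplement ⟨z, hz⟩)

lemma gl_open : IsOpen {z : ℂ | 0 < z.im} := isOpen_lt continuous_const Complex.continuous_im

/-- The derivative of `π cot (π z)`. -/
lemma gl_cot_deriv {z : ℂ} (hz : 0 < z.im) :
    HasDerivAt (fun x : ℂ => (π : ℂ) * Complex.cot (π * x)) (-(π : ℂ) ^ 2 / Complex.sin (π * z) ^ 2) z := by
  have hs := gl_sin_ne hz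
  have h0 : HasDerivAt (fun x : ℂ => (π : ℂ) * x) π z := by
    simpa using (hasDerivAt_id z).const_mul (π : ℂ)
  have h1 : HasDerivAt (fun x : ℂ => Complex.sin (π * x)) (Complex.cos (π * z) * π) z := h0.csin
  have h2 : HasDerivAt (fun x : ℂ => Complex.cos (π * x)) (-Complex.sin (π * z) * π) z := h0.ccos
  have := (h2.div h1 hs).const_mul (π : ℂ)
  refine HasDerivAt.congr_deriv this ?_
  field_simp
  linear_combination -Complex.sin_sq_add_cos_sq (π * z)

lemma gl_iter_deriv (k : ℕ) {z : ℂ} (hz : 0 < z.im) :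
    HasDerivAt (iteratedDeriv k (fun x : ℂ => (π : ℂ) * Complex.cot (π * x)))
      (iteratedDeriv (k + 1) (fun x : ℂ => (π : ℂ) * Complex.cot (π * x)) z) z := by
  have hA : AnalyticOnNhd ℂ (fun x : ℂ => (π : ℂ) * Complex.cot (π * x)) {z : ℂ | 0 < z.im} := by
    apply DifferentiableOn.analyticOnNhd _ gl_open
    intro w hw
    exact (gl_cot_deriv hw).differentiableAt.differentiableWithinAt
  have := (hA.iterated_deriv k) z hz
  rw [iteratedDeriv_succ]
  rw [← iteratedDeriv_eq_iterate] at this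
  exact this.differentiableAt.hasDerivAt

lemma gl_sin_deriv (m : ℕ) {z : ℂ} (hz : 0 < z.im) :
    HasDerivAt (fun x : ℂ => 1 / Complex.sin (π * x) ^ m)
      (-(m * π) * (Complex.cos (π * z) * (1 / Complex.sin (π * z) ^ (m + 1)))) z := by
  have hs := gl_sin_ne hz
  have h0 : HasDerivAt (fun x : ℂ => (π : ℂ) * x) π z := by
    simpa using (hasDerivAt_id z).const_mul (π : ℂ)
  have h1 : HasDerivAt (fun x : ℂ => Complex.sin (π * x)) (Complex.cos (π * z) * π) z := h0.csin
  have h2 := (h1.fun_pow m).fun_inv (pow_ne_zero _ hs)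
  simp only [one_div]
  refine HasDerivAt.congr_deriv h2 ?_
  rcases m with _ | m
  · simp
  · simp only [Nat.add_sub_cancel]
    field_simp
    ring

lemma gl_sin_deriv2 (m : ℕ) {z : ℂ} (hz : 0 < z.im) :
    HasDerivAt (fun z : ℂ => -(m * π) * (Complex.cos (π * z) * (1 / Complex.sin (π * z) ^ (m + 1))))
      (m * π ^ 2 * ((m + 1) * (1 / Complex.sin (π * z) ^ (m + 2)) - m * (1 / Complex.sin (π * z) ^ m))) z := by
  have hs := gl_sin_ne hz
  have h0 : HasDerivAt (fun x : ℂ => (π : ℂ) * x) π z := by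
    simpa using (hasDerivAt_id z).const_mul (π : ℂ)
  have h2 : HasDerivAt (fun x : ℂ => Complex.cos (π * x)) (-Complex.sin (π * z) * π) z := h0.ccos
  refine HasDerivAt.congr_deriv ((h2.fun_mul (gl_sin_deriv (m+1) hz)).const_mul _) ?_
  have e : Complex.cos (π * z) * (-(((m+1 : ℕ) : ℂ) * π) * (Complex.cos (π * z) * (1 / Complex.sin (π * z) ^ (m + 1 + 1)))) = -((m+1) * π) * ((1 - Complex.sin (π * z) ^ 2) * (1 / Complex.sin (π * z) ^ (m + 1 + 1))) := by
    rw [← Complex.cos_sq']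
    push_cast; ring
  rw [e]
  field_simp
  ring

lemma gl_rep (n : ℕ) : ∃ d : ℕ → ℝ, ∀ z : ℂ, 0 < z.im →
    1 / Complex.sin (π * z) ^ (2 * (n + 1)) = ∑ s ∈ range (n + 1), (d s : ℂ) *
      iteratedDeriv (2 * s + 1) (fun x : ℂ => (π : ℂ) * Complex.cot (π * x)) z := by
  induction n with
  | zero =>
    refine ⟨fun _ => -1 / π ^ 2, fun z hz => ?_⟩
    have := gl_sin_ne hz
    have hp : (π : ℂ) ≠ 0 := by exact_mod_cast Real.pi_ne_zero
    simp only [zero_add, range_one, sum_singleton, mul_zero, iteratedDeriv_one]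
    rw [(gl_cot_deriv hz).deriv]
    push_cast
    field_simp
  | succ n ih =>
    obtain ⟨d, hd⟩ := ih
    set C : ℂ → ℂ := fun x : ℂ => (π : ℂ) * Complex.cot (π * x) with hC
    have key1 : ∀ z : ℂ, 0 < z.im → -(((2 * (n+1) : ℕ) : ℂ) * π) * (Complex.cos (π * z) * (1 / Complex.sin (π * z) ^ (2 * (n+1) + 1))) = ∑ s ∈ range (n + 1), (d s : ℂ) * iteratedDeriv (2 * s + 2) C z := by
      intro z hz
      have h1 := gl_sin_deriv (2 * (n+1)) hz
      have h2 : HasDerivAt (fun z => ∑ s ∈ range (n + 1), (d s : ℂ) * iteratedDeriv (2 * s + 1) C z) (∑ s ∈ range (n + 1), (d s : ℂ) * iteratedDeriv (2 * s + 2) C z) z :=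
        HasDerivAt.fun_sum fun s _ => (gl_iter_deriv (2 * s + 1) hz).const_mul _
      exact h1.unique (h2.congr_of_eventuallyEq
        (Filter.eventually_of_mem (gl_open.mem_nhds hz) fun w hw => hd w hw))
    have key2 : ∀ z : ℂ, 0 < z.im → (((2 * (n+1) : ℕ) : ℂ) * π ^ 2 * ((((2 * (n+1) : ℕ) : ℂ) + 1) * (1 / Complex.sin (π * z) ^ (2 * (n+1) + 2)) - ((2 * (n+1) : ℕ) : ℂ) * (1 / Complex.sin (π * z) ^ (2 * (n+1))))) = ∑ s ∈ range (n + 1), (d s : ℂ) * iteratedDeriv (2 * s + 3) C z := by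
      intro z hz
      have h1 := gl_sin_deriv2 (2 * (n+1)) hz
      have h2 : HasDerivAt (fun z => ∑ s ∈ range (n + 1), (d s : ℂ) * iteratedDeriv (2 * s + 2) C z) (∑ s ∈ range (n + 1), (d s : ℂ) * iteratedDeriv (2 * s + 3) C z) z :=
        HasDerivAt.fun_sum fun s _ => (gl_iter_deriv (2 * s + 2) hz).const_mul _
      exact h1.unique (h2.congr_of_eventuallyEq
        (Filter.eventually_of_mem (gl_open.mem_nhds hz) fun w hw => key1 w hw))
    set M : ℝ := ((2 * (n+1) : ℕ) : ℝ) with hM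
    refine ⟨fun s => (M ^ 2 * π ^ 2 * (if s < n + 1 then d s else 0) +
      (if s = 0 then 0 else d (s - 1))) / (M * (M + 1) * π ^ 2), fun z hz => ?_⟩
    have hM0 : 0 < M := by rw [hM]; positivity
    have hM1 : (M : ℂ) ≠ 0 := by exact_mod_cast hM0.ne'
    have hM2 : (M : ℂ) + 1 ≠ 0 := by exact_mod_cast (by positivity : M + 1 ≠ 0)
    have hp : (π : ℂ) ≠ 0 := by exact_mod_cast Real.pi_ne_zero
    have hcast : (((2 * (n+1) : ℕ) : ℂ)) = (M : ℂ) := by rw [hM]; push_cast; rfl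
    have k2 := key2 z hz
    rw [hcast] at k2
    have e1 : ∑ s ∈ range (n + 1 + 1), (((if s < n + 1 then d s else 0 : ℝ)) : ℂ) * iteratedDeriv (2 * s + 1) C z = 1 / Complex.sin (π * z) ^ (2 * (n + 1)) := by
      rw [sum_range_succ, hd z hz]
      simp only [lt_irrefl, if_false, Complex.ofReal_zero, zero_mul, add_zero]
      exact sum_congr rfl fun s hs => by rw [if_pos (mem_range.1 hs)]
    have e2 : ∑ s ∈ range (n + 1 + 1), (((if s = 0 then 0 else d (s - 1) : ℝ)) : ℂ) * iteratedDeriv (2 * s + 1) C z = ∑ s ∈ range (n + 1), (d s : ℂ) * iteratedDeriv (2 * s + 3) C z := by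
      rw [sum_range_succ']
      simp
      rfl
    have e3 : ∀ s : ℕ, (((M ^ 2 * π ^ 2 * (if s < n + 1 then d s else 0) +
      (if s = 0 then 0 else d (s - 1))) / (M * (M + 1) * π ^ 2) : ℝ) : ℂ) * iteratedDeriv (2 * s + 1) C z =
      (M ^ 2 * π ^ 2 * ((((if s < n + 1 then d s else 0 : ℝ)) : ℂ) * iteratedDeriv (2 * s + 1) C z) + (((if s = 0 then 0 else d (s - 1) : ℝ)) : ℂ) * iteratedDeriv (2 * s + 1) C z) / (M * (M + 1) * π ^ 2) := by
      intro s
      rw [Complex.ofReal_div, Complex.ofReal_add, Complex.ofReal_mul (M ^ 2 * π ^ 2)]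
      push_cast
      ring
    simp only [e3]
    rw [← Finset.sum_div, Finset.sum_add_distrib, ← Finset.mul_sum, e1, e2, ← k2,
      eq_div_iff (by positivity)]
    rw [show 2 * (n + 1 + 1) = 2 * (n+1) + 2 by ring]
    ring

lemma gl_rep2 (n : ℕ) : ∃ d : ℕ → ℝ, ∀ z : ℂ, 0 < z.im →
    1 / Complex.sin (π * z) ^ (2 * (n + 1)) = ∑ s ∈ range (n + 1), (d s : ℂ) *
      ∑' k : ℤ, 1 / (z + k) ^ (2 * (s + 1)) := by
  obtain ⟨d, hd⟩ := gl_rep n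
  refine ⟨fun s => d s * ((-1) ^ (2 * s + 1) * (2 * s + 1).factorial), fun z hz => ?_⟩
  rw [hd z hz]
  refine sum_congr rfl fun s _ => ?_
  have := iteratedDerivWithin_cot_pi_mul_eq_mul_tsum_div_pow (k := 2 * s + 1) (by omega) (z := z) hz
  rw [iteratedDerivWithin_of_isOpen gl_open hz] at this
  rw [this]
  push_cast
  ring_nf

lemma gl_summable (x : ℝ) (m : ℕ) (hm : 2 ≤ m) :
    Summable fun k : ℤ => 1 / |x + k| ^ m := by
  have h := (EisensteinSeries.linear_right_summable (x : ℂ) 1 (k := m) (by exact_mod_cast hm)).norm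
  refine h.congr fun k => ?_
  rw [norm_inv, norm_zpow, zpow_natCast, one_div]
  congr 2
  rw [← Real.norm_eq_abs, ← Complex.norm_real]
  push_cast
  ring_nf

lemma gl_rep_real (n : ℕ) : ∃ d : ℕ → ℝ, ∀ x : ℝ, (∀ k : ℤ, x + k ≠ 0) →
    1 / Real.sin (π * x) ^ (2 * (n + 1)) = ∑ s ∈ range (n + 1), d s *
      ∑' k : ℤ, 1 / (x + k) ^ (2 * (s + 1)) := by
  obtain ⟨d, hd⟩ := gl_rep2 n
  refine ⟨d, fun x hx => ?_⟩
  have hsin : Complex.sin (π * x) ≠ 0 := by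
    rw [Complex.sin_ne_zero_iff]
    intro k h
    apply hx (-k)
    have hp : (π : ℂ) ≠ 0 := by exact_mod_cast Real.pi_ne_zero
    have : (x : ℂ) = k := by
      apply mul_left_cancel₀ hp
      rw [h]; ring
    have : x = k := by exact_mod_cast this
    rw [this]; push_cast; ring
  have hz : Tendsto (fun e : ℝ => (x : ℂ) + e * Complex.I) (nhdsWithin 0 (Set.Ioi 0)) (nhds x) := by
    have : Continuous (fun e : ℝ => (x : ℂ) + e * Complex.I) := by fun_prop
    have := this.tendsto 0
    simp only [Complex.ofReal_zero, zero_mul, add_zero] at this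
    exact this.mono_left nhdsWithin_le_nhds
  have h1 : Tendsto (fun e : ℝ => 1 / Complex.sin (π * ((x : ℂ) + e * Complex.I)) ^ (2 * (n + 1)))
      (nhdsWithin 0 (Set.Ioi 0)) (nhds (1 / Complex.sin (π * x) ^ (2 * (n + 1)))) := by
    refine Tendsto.div tendsto_const_nhds (Tendsto.pow ?_ _) (pow_ne_zero _ hsin)
    exact (Complex.continuous_sin.tendsto _).comp (hz.const_mul _)
  have h2 : ∀ s : ℕ, Tendsto (fun e : ℝ => ∑' k : ℤ, 1 / ((x : ℂ) + e * Complex.I + k) ^ (2 * (s + 1)))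
      (nhdsWithin 0 (Set.Ioi 0)) (nhds (∑' k : ℤ, 1 / ((x : ℂ) + k) ^ (2 * (s + 1)))) := by
    intro s
    refine tendsto_tsum_of_dominated_convergence (gl_summable x (2 * (s + 1)) (by omega)) ?_ ?_
    · intro k
      refine Tendsto.div tendsto_const_nhds (Tendsto.pow (hz.add_const _) _) (pow_ne_zero _ ?_)
      exact_mod_cast hx k
    · refine Eventually.of_forall fun e k => ?_
      rw [norm_div, norm_one, norm_pow]
      have : |x + k| ≤ ‖(x : ℂ) + e * Complex.I + k‖ := by
        have := Complex.abs_re_le_norm ((x : ℂ) + e * Complex.I + k)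
        simpa using this
      have h0 : 0 < |x + k| := abs_pos.2 (hx k)
      gcongr
  have h3 := tendsto_finsetSum (range (n + 1)) fun s _ => (h2 s).const_mul (d s : ℂ)
  have h4 : 1 / Complex.sin (π * x) ^ (2 * (n + 1)) = ∑ s ∈ range (n + 1), (d s : ℂ) *
      ∑' k : ℤ, 1 / ((x : ℂ) + k) ^ (2 * (s + 1)) := by
    refine tendsto_nhds_unique (h1.congr' ?_) h3
    filter_upwards [self_mem_nhdsWithin] with e he
    exact hd _ (by simpa using he)
  apply Complex.ofReal_injective
  push_cast
  exact h4

lemma gl_tail_bound (m : ℕ) (hm : 2 ≤ m) : ∃ B : ℝ, ∀ x : ℝ, 0 < x → x ≤ 1 / 2 →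
    |∑' k : ℤ, 1 / (x + k) ^ m - 1 / x ^ m| ≤ B := by
  have hs0 : Summable fun k : ℤ => 2 ^ m * (1 / |(0 : ℝ) + k| ^ m) := (gl_summable 0 m hm).mul_left _
  refine ⟨∑' k : ℤ, 2 ^ m * (1 / |(0 : ℝ) + k| ^ m), fun x hx hx2 => ?_⟩
  have hS : Summable fun k : ℤ => 1 / (x + k) ^ m := by
    refine Summable.of_norm ((gl_summable x m hm).congr fun k => ?_)
    simp
  rw [hS.tsum_eq_add_tsum_ite 0]
  simp only [Int.cast_zero, add_zero, add_sub_cancel_left]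
  rw [← Real.norm_eq_abs]
  refine tsum_of_norm_bounded hs0.hasSum fun k => ?_
  split_ifs with h
  · simp
  · have hk : 1 ≤ |(k : ℝ)| := by exact_mod_cast Int.one_le_abs h
    have h1 : |(k : ℝ)| / 2 ≤ |x + k| := by
      have := abs_sub_abs_le_abs_sub (k : ℝ) (-x)
      rw [abs_neg, abs_of_pos hx, sub_neg_eq_add, add_comm (k : ℝ) x] at this
      linarith
    rw [norm_div, norm_one, norm_pow, Real.norm_eq_abs, zero_add]
    have h2 : 2 ^ m * (1 / |(k : ℝ)| ^ m) = 1 / (|(k : ℝ)| / 2) ^ m := by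
      rw [div_pow]; field_simp
    rw [h2]
    gcongr

lemma gl_poly (n : ℕ) (a : ℕ → ℝ) (B : ℝ)
    (h : ∀ᶠ x in nhdsWithin (0 : ℝ) (Set.Ioi 0), |∑ s ∈ range (n + 1), a s / x ^ (2 * (s + 1))| ≤ B) :
    ∀ s ∈ range (n + 1), a s = 0 := by
  set P : Polynomial ℝ := ∑ s ∈ range (n + 1), Polynomial.C (a s) * Polynomial.X ^ (s + 1) with hP
  have ht : Tendsto (fun y : ℝ => (√y)⁻¹) atTop (nhdsWithin 0 (Set.Ioi 0)) :=
    tendsto_inv_atTop_nhdsGT_zero.comp Real.tendsto_sqrt_atTop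
  have hb : P.degree ≤ 0 := by
    rw [← Polynomial.isBoundedUnder_abs_atTop_iff]
    refine ⟨B, ?_⟩
    rw [eventually_map]
    filter_upwards [ht.eventually h, eventually_gt_atTop 0] with y hy hy0
    refine le_trans (le_of_eq (congrArg abs ?_)) hy
    rw [hP, Polynomial.eval_finsetSum]
    refine sum_congr rfl fun s _ => ?_
    simp only [Polynomial.eval_mul, Polynomial.eval_C, Polynomial.eval_pow, Polynomial.eval_X]
    rw [pow_mul, inv_pow, Real.sq_sqrt hy0.le, inv_pow, div_inv_eq_mul]
  intro s hs
  have hc : P.coeff (s + 1) = a s := by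
    rw [hP, Polynomial.finsetSum_coeff]
    simp only [Polynomial.coeff_C_mul, Polynomial.coeff_X_pow]
    rw [sum_eq_single s]
    · simp
    · intro b _ hb
      rw [if_neg (by omega), mul_zero]
    · exact fun h => absurd hs h
  rw [← hc]
  apply Polynomial.coeff_eq_zero_of_degree_lt
  exact lt_of_le_of_lt hb (by exact_mod_cast Nat.succ_pos s)

/-- Partial fractions with the given Laurent coefficients. -/
lemma gl_partial (n : ℕ) (c : ℕ → ℝ)
    (hc : Filter.Tendsto
        (fun x : ℝ => 1 / Real.sin x ^ (2 * (n + 1)) - ∑ s ∈ Finset.range (n + 1 + 1), c s / x ^ (2 * s))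
        (nhdsWithin 0 {0}ᶜ) (nhds 0)) (x : ℝ) (hx : ∀ k : ℤ, x + k ≠ 0) :
    1 / Real.sin (π * x) ^ (2 * (n + 1)) = ∑ s ∈ range (n + 1), c (s + 1) / π ^ (2 * (s + 1)) *
      ∑' k : ℤ, 1 / (x + k) ^ (2 * (s + 1)) := by
  obtain ⟨d, hd⟩ := gl_rep_real n
  rw [hd x hx]
  choose B hB using fun s : ℕ => gl_tail_bound (2 * (s + 1)) (by omega)
  have ht : Tendsto (fun x : ℝ => π * x) (nhdsWithin 0 (Set.Ioi 0)) (nhdsWithin 0 {0}ᶜ) := by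
    refine tendsto_nhdsWithin_iff.2 ⟨?_, ?_⟩
    · have : Continuous (fun x : ℝ => π * x) := by fun_prop
      have := this.tendsto 0
      rw [mul_zero] at this
      exact this.mono_left nhdsWithin_le_nhds
    · filter_upwards [self_mem_nhdsWithin] with e he
      exact (mul_pos Real.pi_pos he).ne'
  have h1 := hc.comp ht
  have h2 : ∀ᶠ x in nhdsWithin (0 : ℝ) (Set.Ioi 0), |1 / Real.sin (π * x) ^ (2 * (n + 1)) - ∑ s ∈ Finset.range (n + 1 + 1), c s / (π * x) ^ (2 * s)| ≤ 1 := by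
    have := (Metric.tendsto_nhds.1 h1) 1 one_pos
    filter_upwards [this] with e he
    rw [Real.dist_eq, sub_zero] at he
    exact he.le
  have hlt : ∀ᶠ x in nhdsWithin (0 : ℝ) (Set.Ioi 0), x ≤ 1 / 2 :=
    nhdsWithin_le_nhds (eventually_le_nhds (by norm_num))
  have key := gl_poly n (fun s => d s - c (s + 1) / π ^ (2 * (s + 1)))
    (1 + |c 0| + ∑ s ∈ range (n + 1), |d s| * B s) (by
    filter_upwards [h2, hlt, self_mem_nhdsWithin] with y hy hy2 hy0
    have hy0 : 0 < y := hy0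
    have hyk : ∀ k : ℤ, y + k ≠ 0 := by
      intro k hk
      have h1 : (k : ℝ) < 0 := by linarith
      have h2 : (-1 : ℝ) < k := by linarith
      have h1' : k < 0 := by exact_mod_cast h1
      have h2' : -1 < k := by exact_mod_cast h2
      omega
    rw [hd y hyk, sum_range_succ' (fun s => c s / (π * y) ^ (2 * s))] at hy
    have e : ∑ s ∈ range (n + 1), (d s - c (s + 1) / π ^ (2 * (s + 1))) / y ^ (2 * (s + 1)) =
        (∑ s ∈ range (n + 1), d s * ∑' k : ℤ, 1 / (y + k) ^ (2 * (s + 1)) -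
          (∑ s ∈ range (n + 1), c (s + 1) / (π * y) ^ (2 * (s + 1)) + c 0 / (π * y) ^ (2 * 0))) + c 0
        - ∑ s ∈ range (n + 1), d s * (∑' k : ℤ, 1 / (y + k) ^ (2 * (s + 1)) - 1 / y ^ (2 * (s + 1))) := by
      have e1 : ∀ s, (d s - c (s + 1) / π ^ (2 * (s + 1))) / y ^ (2 * (s + 1)) =
          d s * (1 / y ^ (2 * (s + 1))) - c (s + 1) / (π * y) ^ (2 * (s + 1)) := by
        intro s
        rw [mul_pow]
        field_simp
      simp only [e1, mul_zero, pow_zero, div_one, mul_sub, sum_sub_distrib]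
      ring
    rw [e]
    refine (abs_sub _ _).trans (add_le_add ((abs_add_le _ _).trans (add_le_add hy le_rfl)) ?_)
    refine (abs_sum_le_sum_abs _ _).trans (sum_le_sum fun s _ => ?_)
    rw [abs_mul]
    exact mul_le_mul_of_nonneg_left (hB s y hy0 hy2) (abs_nonneg _))
  refine sum_congr rfl fun s hs => ?_
  rw [sub_eq_zero.1 (key s hs)]

lemma gl_sum_zmod (N : ℕ) [NeZero N] (f : ZMod N → ℂ) :
    ∑ a ∈ Icc 1 N, f (a : ZMod N) = ∑ a : ZMod N, f a := by
  refine sum_bij (fun a _ => (a : ZMod N)) (fun _ _ => mem_univ _) ?_ ?_ (fun _ _ => rfl)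
  · intro a ha b hb h
    rw [mem_Icc] at ha hb
    rw [ZMod.natCast_eq_natCast_iff] at h
    have h' : a ≡ b [MOD N] := h
    rcases Nat.lt_or_ge a b with hab | hab
    · have := (Nat.modEq_iff_dvd' hab.le).1 h'
      have := Nat.le_of_dvd (by omega) this
      omega
    · by_contra hne
      have := (Nat.modEq_iff_dvd' hab).1 h'.symm
      have := Nat.le_of_dvd (by omega) this
      omega
  · intro z _
    by_cases hz : z = 0
    · exact ⟨N, mem_Icc.2 ⟨NeZero.one_le, le_rfl⟩, by simp [hz]⟩
    · refine ⟨z.val, mem_Icc.2 ⟨?_, (ZMod.val_lt z).le⟩, by simp⟩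
      exact Nat.one_le_iff_ne_zero.2 ((ZMod.val_ne_zero z).2 hz)

lemma gl_gauss (N : ℕ) [NeZero N] (χ : DirichletCharacter ℂ N)
    (hprim : DirichletCharacter.IsPrimitive χ) (l : ZMod N) :
    ∑ j : ZMod N, χ⁻¹ j * ZMod.stdAddChar (l * j) = χ l * gaussSum χ⁻¹ ZMod.stdAddChar := by
  have hp : DirichletCharacter.IsPrimitive χ⁻¹ := by
    rw [DirichletCharacter.isPrimitive_def, DirichletCharacter.conductor_inv]; exact hprim
  have := gaussSum_mulShift_of_isPrimitive (ZMod.stdAddChar (N := N)) hp l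
  rw [inv_inv] at this
  rw [← this]
  simp [gaussSum]

lemma gl_gauss_ne (N : ℕ) [NeZero N] (χ : DirichletCharacter ℂ N)
    (hprim : DirichletCharacter.IsPrimitive χ) : gaussSum χ⁻¹ (ZMod.stdAddChar (N := N)) ≠ 0 := by
  intro h
  have h1 : ZMod.dft (fun j => χ⁻¹ j) = 0 := by
    ext k
    rw [ZMod.dft_apply]
    have := gl_gauss N χ hprim (-k)
    rw [h, mul_zero] at this
    simp only [smul_eq_mul, Pi.zero_apply]
    rw [← this]
    refine sum_congr rfl fun j _ => ?_
    rw [mul_comm, show -(j * k) = -k * j by ring]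
  have h2 := (LinearEquiv.map_eq_zero_iff _).1 h1
  have h3 := congrFun h2 1
  simp at h3

lemma gl_hasSum_rhs (N : ℕ) [NeZero N] (χ : DirichletCharacter ℂ N)
    (hprim : DirichletCharacter.IsPrimitive χ) (i : ℕ) (hi : 1 ≤ i) :
    HasSum (fun l : ℕ => 1 / (l : ℂ) ^ (2 * i) * (χ l + χ (-l)))
      (∑ j ∈ Icc 1 N, χ⁻¹ (j : ZMod N) / gaussSum χ⁻¹ (ZMod.stdAddChar (N := N)) *
        (-(2 * π * Complex.I) ^ (2 * i) / (2 * i).factorial * bernoulliFun (2 * i) ((j : ℝ) / N))) := by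
  have hG := gl_gauss_ne N χ hprim
  set G := gaussSum χ⁻¹ (ZMod.stdAddChar (N := N)) with hGdef
  have hN : (0 : ℝ) < N := by exact_mod_cast NeZero.pos N
  have h1 : ∀ j ∈ Icc 1 N, HasSum (fun l : ℕ => χ⁻¹ (j : ZMod N) / G * ((1 : ℂ) / (l : ℂ) ^ (2 * i) *
      (ZMod.stdAddChar ((l : ZMod N) * (j : ZMod N)) + ZMod.stdAddChar (-(l : ZMod N) * (j : ZMod N)))))
      (χ⁻¹ (j : ZMod N) / G * (-(2 * π * Complex.I) ^ (2 * i) / (2 * i).factorial *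
        bernoulliFun (2 * i) ((j : ℝ) / N))) := by
    intro j hj
    rw [mem_Icc] at hj
    have hx : (j : ℝ) / N ∈ Set.Icc (0 : ℝ) 1 := by
      refine ⟨by positivity, ?_⟩
      rw [div_le_one hN]
      exact_mod_cast hj.2
    have := hasSum_one_div_nat_pow_mul_fourier (k := 2 * i) (by omega) hx
    refine HasSum.mul_left _ ?_
    refine this.congr_fun fun l => ?_
    refine congrArg _ ?_
    rw [show (-1 : ℂ) ^ (2 * i) = 1 by rw [pow_mul]; simp, one_mul, fourier_coe_apply, fourier_coe_apply]
    rw [show ((l : ZMod N) * (j : ZMod N)) = (((l * j : ℤ)) : ZMod N) by push_cast; rfl,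
      show (-(l : ZMod N) * (j : ZMod N)) = (((-l * j : ℤ)) : ZMod N) by push_cast; rfl,
      ZMod.stdAddChar_coe, ZMod.stdAddChar_coe]
    congr 2
    · push_cast; ring
    · push_cast; ring
  have h2 := hasSum_sum h1
  refine h2.congr_fun fun l => ?_
  rw [gl_sum_zmod N (fun j => χ⁻¹ j / G * ((1 : ℂ) / (l : ℂ) ^ (2 * i) *
      (ZMod.stdAddChar ((l : ZMod N) * (j : ZMod N)) + ZMod.stdAddChar (-(l : ZMod N) * (j : ZMod N)))))]
  have e : ∀ j : ZMod N, χ⁻¹ j / G * ((1 : ℂ) / (l : ℂ) ^ (2 * i) *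
      (ZMod.stdAddChar ((l : ZMod N) * (j : ZMod N)) + ZMod.stdAddChar (-(l : ZMod N) * (j : ZMod N)))) =
      (1 : ℂ) / (l : ℂ) ^ (2 * i) / G * (χ⁻¹ j * ZMod.stdAddChar ((l : ZMod N) * (j : ZMod N))
        + χ⁻¹ j * ZMod.stdAddChar (-(l : ZMod N) * (j : ZMod N))) := fun j => by ring
  simp only [e]
  rw [← mul_sum, sum_add_distrib, gl_gauss N χ hprim, gl_gauss N χ hprim, ← hGdef]
  field_simp

lemma gl_summable_chi (N : ℕ) [NeZero N] (χ : DirichletCharacter ℂ N) (i : ℕ) (hi : 1 ≤ i) :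
    Summable fun l : ℤ => χ l * (1 / (l : ℂ) ^ (2 * i)) := by
  refine Summable.of_norm_bounded (gl_summable 0 (2 * i) (by omega)) fun l => ?_
  rw [norm_mul, norm_div, norm_one, norm_pow, zero_add, Complex.norm_intCast]
  exact mul_le_of_le_one_left (by positivity) (χ.norm_le_one _)

lemma gl_lhs (N : ℕ) [NeZero N] (hN : 2 < N) (χ : DirichletCharacter ℂ N) (i : ℕ) (hi : 1 ≤ i) :
    ∑ m ∈ Icc 1 (N - 1), χ (m : ZMod N) * ∑' k : ℤ, 1 / ((m : ℂ) / N + k) ^ (2 * i) =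
      (N : ℂ) ^ (2 * i) * ∑' l : ℤ, χ l * (1 / (l : ℂ) ^ (2 * i)) := by
  have hs := gl_summable_chi N χ i hi
  set e : Fin N × ℤ ≃ ℤ := (Equiv.prodComm _ _).trans (Int.divModEquiv N).symm with he
  have hN0 : (N : ℂ) ≠ 0 := NeZero.ne _
  have hχ0 : χ 0 = 0 := by
    have : Fact (1 < N) := ⟨by omega⟩
    exact χ.map_nonunit not_isUnit_zero
  have hs' := ((e.summable_iff).2 hs).tsum_prod
  simp only [Function.comp_apply] at hs'
  rw [← e.tsum_eq, hs', tsum_fintype]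
  have h1 : ∀ r : Fin N, ∑' k : ℤ, χ ((e (r, k) : ℤ) : ZMod N) * (1 / ((e (r, k) : ℤ) : ℂ) ^ (2 * i))
      = (fun m : ℕ => χ (m : ZMod N) * ∑' k : ℤ, 1 / ((m : ℂ) + k * N) ^ (2 * i)) r := by
    intro r
    simp only
    rw [← tsum_mul_left]
    refine tsum_congr fun k => ?_
    have : e (r, k) = k * N + r := by rw [he]; simp [Int.divModEquiv_symm_apply]
    rw [this]
    push_cast
    rw [ZMod.natCast_self, mul_zero, zero_add, add_comm (r : ℂ)]
  have h2 : ∑ r : Fin N, ∑' k : ℤ, χ ((e (r, k) : ℤ) : ZMod N) * (1 / ((e (r, k) : ℤ) : ℂ) ^ (2 * i))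
    = ∑ m ∈ range N, χ (m : ZMod N) * ∑' k : ℤ, 1 / ((m : ℂ) + k * N) ^ (2 * i) := by
    rw [sum_range]
    exact sum_congr rfl fun r _ => h1 r
  rw [h2]
  have h3 : range N = insert 0 (Icc 1 (N - 1)) := by
    ext m; simp only [mem_range, mem_insert, mem_Icc]; omega
  rw [h3, sum_insert (by simp)]
  simp only [Nat.cast_zero, hχ0, zero_mul, zero_add]
  rw [mul_sum]
  refine sum_congr rfl fun m _ => ?_
  rw [mul_left_comm, ← tsum_mul_left (a := (N : ℂ) ^ (2 * i))]
  refine congrArg _ ?_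
  refine tsum_congr fun k : ℤ => ?_
  rw [show (m : ℂ) / N + k = (m + k * N) / N by field_simp, div_pow, one_div_div, mul_one_div]

lemma gl_main (N : ℕ) [NeZero N] (hN : 2 < N) (χ : DirichletCharacter ℂ N)
    (hprim : DirichletCharacter.IsPrimitive χ) (i : ℕ) (hi : 1 ≤ i) :
    ∑ m ∈ Icc 1 (N - 1), χ (m : ZMod N) * ∑' k : ℤ, 1 / ((m : ℂ) / N + k) ^ (2 * i) =
      (N : ℂ) ^ (2 * i) * (∑ j ∈ Icc 1 N, χ⁻¹ (j : ZMod N) / gaussSum χ⁻¹ (ZMod.stdAddChar (N := N)) *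
        (-(2 * π * Complex.I) ^ (2 * i) / (2 * i).factorial * bernoulliFun (2 * i) ((j : ℝ) / N))) := by
  rw [gl_lhs N hN χ i hi]
  congr 1
  have h1 := (gl_summable_chi N χ i hi).hasSum.nat_add_neg
  have h2 := gl_hasSum_rhs N χ hprim i hi
  have h0 : (χ ((0 : ℤ) : ZMod N) * (1 / ((0 : ℤ) : ℂ) ^ (2 * i))) = 0 := by
    rw [Int.cast_zero (R := ℂ), zero_pow (by omega)]; simp
  rw [h0, add_zero] at h1
  refine h1.unique (h2.congr_fun ?_)
  intro l
  have : (-(l : ℂ)) ^ (2 * i) = (l : ℂ) ^ (2 * i) := Even.neg_pow (even_two_mul i) _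
  push_cast
  rw [this]
  ring

theorem graph_LFunction_eq_bernoulliPoly_sum (c : ℕ → ℕ → ℝ)
    (hc : ∀ g : ℕ, 1 ≤ g →
      Filter.Tendsto
        (fun x : ℝ => 1 / Real.sin x ^ (2 * g) - ∑ s ∈ Finset.range (g + 1), c g s / x ^ (2 * s))
        (nhdsWithin 0 {0}ᶜ) (nhds 0))
    (N : ℕ) [NeZero N] (hN : 2 < N) (χ : DirichletCharacter ℂ N)
    (hprim : DirichletCharacter.IsPrimitive χ) (heven : χ (-1) = 1) (n : ℕ) (hn : 1 ≤ n) :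
    ∑ m ∈ Finset.Icc 1 (N - 1), χ (m : ZMod N) / ((Real.sin ((m : ℝ) * π / N) : ℂ)) ^ (2 * n) =
      ∑ j ∈ Finset.Icc 1 N,
        ((starRingEnd ℂ) (χ (j : ZMod N)) /
            ∑ a ∈ Finset.Icc 1 N,
              (starRingEnd ℂ) (χ (a : ZMod N)) *
                Complex.exp (2 * π * Complex.I * (a : ℂ) / (N : ℂ))) *
          ∑ i ∈ Finset.Icc 1 n,
            ((-1) ^ (i - 1) * 2 ^ (2 * i) *
                ((Polynomial.eval ((j : ℚ) / (N : ℚ)) (Polynomial.bernoulli (2 * i)) : ℚ) : ℂ) /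
                (Nat.factorial (2 * i) : ℂ)) *
              (c n i : ℂ) * (N : ℂ) ^ (2 * i) := by
  obtain ⟨n, rfl⟩ : ∃ n', n = n' + 1 := ⟨n - 1, by omega⟩
  have hNR : (0 : ℝ) < N := by exact_mod_cast NeZero.pos N
  have hp : (π : ℂ) ≠ 0 := by exact_mod_cast Real.pi_ne_zero
  have hconj : ∀ a : ZMod N, (starRingEnd ℂ) (χ a) = χ⁻¹ a := fun a => MulChar.star_apply' χ a
  have hG : ∑ a ∈ Finset.Icc 1 N, (starRingEnd ℂ) (χ (a : ZMod N)) *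
      Complex.exp (2 * π * Complex.I * (a : ℂ) / (N : ℂ)) = gaussSum χ⁻¹ (ZMod.stdAddChar (N := N)) := by
    rw [gaussSum, ← gl_sum_zmod N (fun a => χ⁻¹ a * ZMod.stdAddChar a)]
    refine sum_congr rfl fun a _ => ?_
    rw [hconj]
    have := ZMod.stdAddChar_coe (N := N) (a : ℤ)
    push_cast at this
    rw [this]
  rw [hG]
  set G := gaussSum χ⁻¹ (ZMod.stdAddChar (N := N)) with hGdef
  have hbern : ∀ j i : ℕ, ((Polynomial.eval ((j : ℚ) / (N : ℚ)) (Polynomial.bernoulli (2 * i)) : ℚ) : ℂ)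
      = ((bernoulliFun (2 * i) ((j : ℝ) / N) : ℝ) : ℂ) := by
    intro j i
    have : bernoulliFun (2 * i) ((j : ℝ) / N) =
        ((Polynomial.eval ((j : ℚ) / (N : ℚ)) (Polynomial.bernoulli (2 * i)) : ℚ) : ℝ) := by
      rw [bernoulliFun, Polynomial.eval_map]
      have h := Polynomial.eval₂_at_apply (p := Polynomial.bernoulli (2 * i)) (algebraMap ℚ ℝ) ((j : ℚ) / N)
      simpa using h
    rw [this]
    norm_cast
  have hleft : ∀ m ∈ Icc 1 (N - 1), χ (m : ZMod N) / ((Real.sin ((m : ℝ) * π / N) : ℂ)) ^ (2 * (n + 1)) =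
      ∑ s ∈ range (n + 1), (c (n + 1) (s + 1) : ℂ) / π ^ (2 * (s + 1)) *
        (χ (m : ZMod N) * ∑' k : ℤ, 1 / ((m : ℂ) / N + k) ^ (2 * (s + 1))) := by
    intro m hm
    rw [mem_Icc] at hm
    have hx : ∀ k : ℤ, (m : ℝ) / N + k ≠ 0 := by
      intro k hk
      have h1 : (m : ℝ) + k * N = 0 := by field_simp at hk; linarith
      have h2 : (m : ℤ) + k * N = 0 := by exact_mod_cast h1
      have h3 : (N : ℤ) ∣ m := ⟨-k, by linarith⟩
      have := Nat.le_of_dvd (by omega) (Int.natCast_dvd_natCast.1 h3)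
      omega
    have h := gl_partial n (c (n + 1)) (hc (n + 1) (by omega)) ((m : ℝ) / N) hx
    have h' := congrArg (fun r : ℝ => (r : ℂ)) h
    push_cast at h'
    rw [div_eq_mul_one_div, show (m : ℝ) * π / N = π * (m / N) by ring]
    push_cast
    rw [h', mul_sum]
    exact sum_congr rfl fun s _ => by ring
  rw [sum_congr rfl hleft, sum_comm]
  simp only [← mul_sum]
  have hmain := fun s : ℕ => gl_main N hN χ hprim (s + 1) (by omega)
  simp only [hmain, ← hGdef, hbern, hconj]
  have hIcc : ∀ f : ℕ → ℂ, ∑ i ∈ Icc 1 (n + 1), f i = ∑ s ∈ range (n + 1), f (s + 1) := by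
    intro f
    rw [← Finset.Ico_add_one_right_eq_Icc, sum_Ico_eq_sum_range]
    simp [add_comm]
  simp only [hIcc]
  simp only [mul_sum]
  rw [sum_comm]
  refine sum_congr rfl fun j _ => sum_congr rfl fun s _ => ?_
  have hI : -(2 * (π : ℂ) * Complex.I) ^ (2 * (s + 1)) = (-1) ^ s * 2 ^ (2 * (s + 1)) * π ^ (2 * (s + 1)) := by
    rw [mul_pow, mul_pow, pow_mul Complex.I, Complex.I_sq]
    ring
  rw [hI, Nat.add_sub_cancel]
  field_simp
end

section
/- For all integers N ≥ 3 and n ≥ 1, the average of even-character L-values satisfies (2/φ(N)) · ∑_{χ even mod N} L(2n, χ) = (π^{2n} / ((2n−1)! N^{2n})) · ∑_{i=1}^{n} a_{n,i} / sin^{2i}(π/N), where the sum runs over all even Dirichlet characters modulo N and φ is Euler's totient function. -/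
open Finset Filter Real

/-- The number of cyclic descents of a permutation `σ` of `{0, …, n-1}`, read cyclically:
positions `i` with `σ(i) > σ(i+1)`, indices mod `n`. -/
def cyclicDescents (n : ℕ) (σ : Equiv.Perm (Fin n)) : ℕ :=
  (Finset.univ.filter (fun i : Fin n => σ (finRotate n i) < σ i)).card

/-- The circular Eulerian number `Ā(n,l)`: the number of circular `n`-permutations with exactly
`l` descents.  Each circular permutation has exactly `n` linear representatives (all with the
same number of cyclic descents), whence the division by `n`. -/
def circEulerian (n l : ℕ) : ℕ :=
  (Finset.univ.filter (fun σ : Equiv.Perm (Fin n) => cyclicDescents n σ = l)).card / n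

/-- The coefficient `t(k,i) = (-1)^(k-i) 2^(2i) (k/(k+i)) C(k+i, k-i)` of the Chebyshev
polynomial of the first kind, with the convention `t(0,0) = 1/2`. -/
noncomputable def tCoeff (k i : ℕ) : ℝ :=
  if k = 0 ∧ i = 0 then 1 / 2
  else (-1) ^ (k - i) * 2 ^ (2 * i) * ((k : ℝ) / ((k : ℝ) + (i : ℝ))) *
    (Nat.choose (k + i) (k - i) : ℝ)

/-- The coefficient `u(k,i) = (-1)^(k-i) 2^(2i) C(k+i, k-i)` of the Chebyshev polynomial of the
second kind. -/
noncomputable def uCoeff (k i : ℕ) : ℝ :=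
  (-1) ^ (k - i) * 2 ^ (2 * i) * (Nat.choose (k + i) (k - i) : ℝ)

/-- `a_{n,i} = 2 ∑_{l=1}^{i} (-1)^(n-l) t(n-l, n-i) Ā(2n, l)`. -/
noncomputable def aCoeff (n i : ℕ) : ℝ :=
  2 * ∑ l ∈ Finset.Icc 1 i, (-1) ^ (n - l) * tCoeff (n - l) (n - i) *
    (circEulerian (2 * n) l : ℝ)

/-- `b_{n,i} = ∑_{l=1}^{i} (-1)^(n-l) u(n-l, n-i) Ā(2n+1, l)`. -/
noncomputable def bCoeff (n i : ℕ) : ℝ :=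
  ∑ l ∈ Finset.Icc 1 i, (-1) ^ (n - l) * uCoeff (n - l) (n - i) *
    (circEulerian (2 * n + 1) l : ℝ)


/-- Descents of `σ` at positions different from `j`. -/
def desAt (m : ℕ) (j : Fin (m + 1)) (σ : Equiv.Perm (Fin (m + 1))) : ℕ :=
  (Finset.univ.filter (fun i : Fin (m + 1) => i ≠ j ∧ σ (i + 1) < σ i)).card

/-- Generating polynomial of cyclic descents. -/
noncomputable def cycPoly (n : ℕ) : Polynomial ℕ :=
  ∑ σ : Equiv.Perm (Fin n), Polynomial.X ^ cyclicDescents n σ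

/-- Generating polynomial of linear descents. -/
noncomputable def desPoly (m : ℕ) : Polynomial ℕ :=
  ∑ σ : Equiv.Perm (Fin (m + 1)), Polynomial.X ^ desAt m (Fin.last m) σ

lemma cyclicDescents_eq (m : ℕ) (σ : Equiv.Perm (Fin (m + 1))) :
    cyclicDescents (m + 1) σ =
      (Finset.univ.filter (fun i : Fin (m + 1) => σ (i + 1) < σ i)).card := by
  unfold cyclicDescents
  simp

lemma cyclicDescents_shift (m : ℕ) (k : Fin (m + 1)) (σ : Equiv.Perm (Fin (m + 1))) :
    cyclicDescents (m + 1) ((Equiv.addRight k).trans σ) = cyclicDescents (m + 1) σ := by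
  rw [cyclicDescents_eq, cyclicDescents_eq]
  refine Finset.card_bij (fun i _ => i + k) ?_ ?_ ?_
  · intro i hi
    rw [mem_filter] at hi ⊢
    simp only [mem_univ, true_and, Equiv.trans_apply, Equiv.coe_addRight] at hi ⊢
    rwa [add_right_comm] at hi
  · intro a _ b _ h
    exact add_right_cancel h
  · intro b hb
    refine ⟨b - k, ?_, by simp⟩
    rw [mem_filter] at hb ⊢
    simp only [mem_univ, true_and, Equiv.trans_apply, Equiv.coe_addRight] at hb ⊢
    rw [add_right_comm]
    simpa using hb

lemma desAt_shift (m : ℕ) (j k : Fin (m + 1)) (σ : Equiv.Perm (Fin (m + 1))) :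
    desAt m j ((Equiv.addRight k).trans σ) = desAt m (j + k) σ := by
  unfold desAt
  refine Finset.card_bij (fun i _ => i + k) ?_ ?_ ?_
  · intro i hi
    rw [mem_filter] at hi ⊢
    simp only [mem_univ, true_and, Equiv.trans_apply, Equiv.coe_addRight] at hi ⊢
    rw [add_right_comm] at hi
    exact ⟨fun h => hi.1 (add_right_cancel h), hi.2⟩
  · intro a _ b _ h
    exact add_right_cancel h
  · intro b hb
    refine ⟨b - k, ?_, by simp⟩
    rw [mem_filter] at hb ⊢
    simp only [mem_univ, true_and, Equiv.trans_apply, Equiv.coe_addRight] at hb ⊢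
    rw [add_right_comm]
    refine ⟨fun h => hb.1 (by rw [← h]; simp), by simpa using hb.2⟩

/-- precomposition by a shift, as a permutation of permutations -/
def shiftEquiv (m : ℕ) (k : Fin (m + 1)) :
    Equiv.Perm (Fin (m + 1)) ≃ Equiv.Perm (Fin (m + 1)) where
  toFun σ := (Equiv.addRight k).trans σ
  invFun σ := (Equiv.addRight k).symm.trans σ
  left_inv σ := by ext; simp
  right_inv σ := by ext; simp

lemma desPoly_eq (m : ℕ) (j : Fin (m + 1)) :
    desPoly m = ∑ σ : Equiv.Perm (Fin (m + 1)), Polynomial.X ^ desAt m j σ := by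
  unfold desPoly
  symm
  apply Fintype.sum_equiv (shiftEquiv m (j - Fin.last m))
  intro σ
  congr 1
  change _ = desAt m _ ((Equiv.addRight _).trans σ)
  rw [desAt_shift]
  simp

lemma desAt_eq (m : ℕ) (j : Fin (m + 1)) (σ : Equiv.Perm (Fin (m + 1))) :
    cyclicDescents (m + 1) σ = desAt m j σ + if σ (j + 1) < σ j then 1 else 0 := by
  rw [cyclicDescents_eq]
  unfold desAt
  simp only [Finset.card_filter]
  rw [← Finset.add_sum_erase _ _ (Finset.mem_univ j),
    ← Finset.add_sum_erase (a := j) _ (fun i => if i ≠ j ∧ σ (i + 1) < σ i then 1 else 0)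
      (Finset.mem_univ j)]
  simp only [ne_eq, not_true_eq_false, false_and, if_false, zero_add]
  rw [add_comm]
  congr 1
  apply Finset.sum_congr rfl
  intro i hi
  have : i ≠ j := (Finset.mem_erase.mp hi).1
  simp [this]

lemma cyclicDescents_le (m : ℕ) (σ : Equiv.Perm (Fin (m + 1))) :
    cyclicDescents (m + 1) σ ≤ m + 1 := by
  unfold cyclicDescents
  exact (Finset.card_filter_le _ _).trans (by simp)

open Polynomial in
lemma desPoly_rec (m : ℕ) :
    ((m + 1 : ℕ) : ℤ[X]) * (desPoly m).map (Nat.castRingHom ℤ) =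
      (1 - X) * derivative ((cycPoly (m + 1)).map (Nat.castRingHom ℤ)) +
        ((m + 1 : ℕ) : ℤ[X]) * (cycPoly (m + 1)).map (Nat.castRingHom ℤ) := by
  have h1 : ((m + 1 : ℕ) : ℤ[X]) * (desPoly m).map (Nat.castRingHom ℤ) =
      ∑ j : Fin (m + 1), (desPoly m).map (Nat.castRingHom ℤ) := by simp
  rw [h1]
  have h2 : ∀ j : Fin (m + 1), (desPoly m).map (Nat.castRingHom ℤ) =
      ∑ σ : Equiv.Perm (Fin (m + 1)), (X : ℤ[X]) ^ desAt m j σ := by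
    intro j
    rw [desPoly_eq m j]
    simp [Polynomial.map_sum]
  rw [Finset.sum_congr rfl (fun j _ => h2 j), Finset.sum_comm]
  simp only [cycPoly, Polynomial.map_sum, Polynomial.map_pow, Polynomial.map_X,
    derivative_sum, Finset.mul_sum]
  rw [← Finset.sum_add_distrib]
  apply Finset.sum_congr rfl
  intro σ _
  set d := cyclicDescents (m + 1) σ with hd
  have h3 : ∀ j : Fin (m + 1), (X : ℤ[X]) ^ desAt m j σ =
      if σ (j + 1) < σ j then X ^ (d - 1) else X ^ d := by
    intro j
    have := desAt_eq m j σ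
    rw [← hd] at this
    split_ifs with h
    · rw [if_pos h] at this
      congr 1; omega
    · rw [if_neg h] at this
      congr 1; omega
  rw [Finset.sum_congr rfl (fun j _ => h3 j), Finset.sum_ite]
  simp only [Finset.sum_const]
  have hc := Finset.card_filter_add_card_filter_not (s := (Finset.univ : Finset (Fin (m + 1))))
    (fun i : Fin (m + 1) => σ (i + 1) < σ i)
  rw [cyclicDescents_eq] at hd
  rw [← hd] at hc ⊢
  rw [show #(univ.filter fun x : Fin (m + 1) => ¬ σ (x + 1) < σ x) = m + 1 - d by
    simp only [Finset.card_univ, Fintype.card_fin] at hc; omega]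
  have hle : d ≤ m + 1 := by
    simp only [Finset.card_univ, Fintype.card_fin] at hc; omega
  obtain ⟨e, he⟩ := Nat.exists_eq_add_of_le hle
  rw [he]
  rcases d with _ | d
  · simp
  · simp
    ring

lemma cyclicDescents_decompose (m : ℕ) (e : Equiv.Perm (Fin (m + 1))) :
    cyclicDescents (m + 2) (Equiv.Perm.decomposeFin.symm (0, e)) =
      desAt m (Fin.last m) e + 1 := by
  rw [cyclicDescents_eq]
  unfold desAt
  simp only [Finset.card_filter]
  rw [Fin.sum_univ_succ]
  simp only [Equiv.Perm.decomposeFin_symm_apply_zero, Fin.not_lt_zero, if_false, zero_add,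
    Equiv.Perm.decomposeFin_symm_apply_succ, Equiv.swap_self, Equiv.refl_apply]
  rw [← Finset.add_sum_erase _ _ (Finset.mem_univ (Fin.last m)),
    ← Finset.add_sum_erase (a := Fin.last m) _
      (fun i => if i ≠ Fin.last m ∧ e (i + 1) < e i then 1 else 0) (Finset.mem_univ _)]
  rw [Fin.succ_last, Fin.last_add_one, Equiv.Perm.decomposeFin_symm_apply_zero,
    if_pos (Fin.succ_pos _), add_comm]
  simp only [ne_eq, not_true_eq_false, false_and, if_false, zero_add]
  congr 1
  apply Finset.sum_congr rfl
  intro i hi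
  have hi' : i ≠ Fin.last m := (Finset.mem_erase.mp hi).1
  have : i.succ + 1 = (i + 1).succ := by
    ext
    have h1 : (i : ℕ) < m := Fin.val_lt_last hi'
    rw [Fin.val_add_one_of_lt (by rw [Fin.lt_def]; simp; omega), Fin.val_succ, Fin.val_succ,
      Fin.val_add_one_of_lt (by rw [Fin.lt_def]; simp; omega)]
  rw [this, Equiv.Perm.decomposeFin_symm_apply_succ]
  simp [hi']

open Polynomial in
lemma cycPoly_succ (m : ℕ) :
    cycPoly (m + 2) = ((m + 2 : ℕ) : ℕ[X]) * (X * desPoly m) := by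
  unfold cycPoly
  have h1 : ∀ σ : Equiv.Perm (Fin (m + 2)), (X : ℕ[X]) ^ cyclicDescents (m + 2) σ =
      ∑ p : Fin (m + 2), if σ p = 0 then X ^ cyclicDescents (m + 2) σ else 0 := by
    intro σ
    rw [Finset.sum_eq_single (σ.symm 0)]
    · simp
    · intro b _ hb
      rw [if_neg]
      intro h
      exact hb (by rw [← h]; simp)
    · simp
  rw [Finset.sum_congr rfl (fun σ _ => h1 σ), Finset.sum_comm]
  have h2 : ∀ p : Fin (m + 2), (∑ σ : Equiv.Perm (Fin (m + 2)),
      if σ p = 0 then (X : ℕ[X]) ^ cyclicDescents (m + 2) σ else 0) = X * desPoly m := by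
    intro p
    rw [Fintype.sum_equiv (shiftEquiv (m + 1) p) _
      (fun σ => if σ 0 = 0 then (X : ℕ[X]) ^ cyclicDescents (m + 2) σ else 0)]
    · rw [Fintype.sum_equiv Equiv.Perm.decomposeFin _
        (fun x => if x.1 = 0 then
          (X : ℕ[X]) ^ cyclicDescents (m + 2) (Equiv.Perm.decomposeFin.symm x) else 0)]
      · rw [Fintype.sum_prod_type, Finset.sum_eq_single 0]
        · simp only [if_true, cyclicDescents_decompose, pow_succ, desPoly, Finset.mul_sum]
          exact Finset.sum_congr rfl (fun _ _ => mul_comm _ _)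
        · intro b _ hb
          simp [hb]
        · simp
      · intro σ
        have : (Equiv.Perm.decomposeFin σ).1 = σ 0 := by
          obtain ⟨x, rfl⟩ := Equiv.Perm.decomposeFin.symm.surjective σ
          rw [Equiv.apply_symm_apply]
          exact (Equiv.Perm.decomposeFin_symm_apply_zero x.1 x.2).symm
        rw [this, Equiv.symm_apply_apply]
    · intro σ
      have : (shiftEquiv (m + 1) p σ) 0 = σ p := by simp [shiftEquiv]
      rw [this]
      have : cyclicDescents (m + 2) (shiftEquiv (m + 1) p σ) = cyclicDescents (m + 2) σ :=
        cyclicDescents_shift (m + 1) p σ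
      rw [this]
  rw [Finset.sum_congr rfl (fun p _ => h2 p)]
  simp

lemma cycPoly_coeff (n l : ℕ) : (cycPoly n).coeff l =
    (Finset.univ.filter (fun σ : Equiv.Perm (Fin n) => cyclicDescents n σ = l)).card := by
  unfold cycPoly
  rw [Polynomial.finsetSum_coeff, Finset.card_filter]
  simp only [Polynomial.coeff_X_pow, eq_comm]

lemma circEulerian_eq_coeff (m l : ℕ) :
    circEulerian (m + 2) l = (Polynomial.X * desPoly m).coeff l := by
  unfold circEulerian
  rw [← cycPoly_coeff, cycPoly_succ, Polynomial.coeff_natCast_mul]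
  simp

lemma circEulerian_zero (m : ℕ) : circEulerian (m + 2) 0 = 0 := by
  rw [circEulerian_eq_coeff]; simp

lemma cyclicDescents_rev (m : ℕ) (σ : Equiv.Perm (Fin (m + 2))) :
    cyclicDescents (m + 2) (σ.trans Fin.revPerm) + cyclicDescents (m + 2) σ = m + 2 := by
  rw [cyclicDescents_eq, cyclicDescents_eq]
  have hc := Finset.card_filter_add_card_filter_not (s := (Finset.univ : Finset (Fin (m + 2))))
    (fun i : Fin (m + 2) => σ (i + 1) < σ i)
  simp only [Finset.card_univ, Fintype.card_fin] at hc
  rw [add_comm]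
  refine Eq.trans ?_ hc
  congr 2
  ext i
  simp only [Equiv.trans_apply, Fin.revPerm_apply, Fin.rev_lt_rev, mem_filter, mem_univ, true_and,
    not_lt]
  refine ⟨le_of_lt, fun h => lt_of_le_of_ne h ?_⟩
  intro h2
  have := σ.injective h2
  simp at this

lemma circEulerian_symm (m l : ℕ) (hl : l ≤ m + 2) :
    circEulerian (m + 2) (m + 2 - l) = circEulerian (m + 2) l := by
  unfold circEulerian
  congr 1
  refine Finset.card_bij (fun σ _ => σ.trans Fin.revPerm) ?_ ?_ ?_
  · intro σ hσ
    have := cyclicDescents_rev m σ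
    simp only [mem_filter, mem_univ, true_and] at hσ ⊢
    omega
  · intro a _ b _ h
    refine Equiv.ext fun i => ?_
    have := DFunLike.congr_fun h i
    simpa using this
  · intro b hb
    refine ⟨b.trans Fin.revPerm, ?_, ?_⟩
    · have := cyclicDescents_rev m b
      simp only [mem_filter, mem_univ, true_and] at hb ⊢
      omega
    · ext i; simp

lemma circEulerian_top (m l : ℕ) (hl : m + 2 < l) : circEulerian (m + 2) l = 0 := by
  unfold circEulerian
  rw [Finset.card_eq_zero.mpr]
  · simp
  · rw [Finset.filter_eq_empty_iff]
    intro σ _ h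
    have : cyclicDescents (m + 2) σ ≤ m + 2 := cyclicDescents_le (m + 1) σ
    omega

open Polynomial in
/-- The Eulerian polynomials, by recursion (index shifted by one). -/
noncomputable def eulP : ℕ → ℂ[X]
  | 0 => C (1 / 2) * (1 + X)
  | k + 1 => X * ((1 - X) * derivative (eulP k) + ((k + 1 : ℕ) : ℂ[X]) * eulP k)

open Polynomial in
lemma eulP_eq (m : ℕ) : eulP (m + 1) = (X * desPoly m).map (Nat.castRingHom ℂ) := by
  have hrec : ∀ m, ((m + 1 : ℕ) : ℂ[X]) * (desPoly m).map (Nat.castRingHom ℂ) =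
      (1 - X) * derivative ((cycPoly (m + 1)).map (Nat.castRingHom ℂ)) +
        ((m + 1 : ℕ) : ℂ[X]) * (cycPoly (m + 1)).map (Nat.castRingHom ℂ) := by
    intro m
    have := congrArg (Polynomial.map (Int.castRingHom ℂ)) (desPoly_rec m)
    have hcomp : (Int.castRingHom ℂ).comp (Nat.castRingHom ℤ) = Nat.castRingHom ℂ := by
      ext; simp
    simp only [Polynomial.map_mul, Polynomial.map_add, Polynomial.map_sub, Polynomial.map_one,
      Polynomial.map_X, Polynomial.map_natCast, Polynomial.map_map, ← Polynomial.derivative_map,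
      hcomp] at this
    exact this
  induction m with
  | zero =>
    have h0 : cycPoly 1 = 1 := by
      unfold cycPoly
      simp [cyclicDescents]
    have := hrec 0
    rw [h0] at this
    simp at this
    simp only [Polynomial.map_mul, Polynomial.map_X, this, eulP]
    simp
    have h2 : (C (2⁻¹ : ℂ)) * 2 = 1 := by
      rw [show (2 : ℂ[X]) = C 2 from rfl, ← C_mul]; norm_num
    linear_combination h2
  | succ m ih =>
    have h := hrec (m + 1)
    rw [cycPoly_succ] at h
    rw [eulP, ih]
    have hne : ((m + 1 + 1 : ℕ) : ℂ[X]) ≠ 0 := by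
      exact_mod_cast (by omega : m + 1 + 1 ≠ 0)
    apply mul_left_cancel₀ hne
    simp only [Polynomial.map_mul, Polynomial.map_X, Polynomial.map_natCast] at h ⊢
    rw [derivative_natCast_mul] at h
    linear_combination (-X) * h

lemma eulP_eval (m : ℕ) (q : ℂ) : (eulP (m + 1)).eval q =
    ∑ l ∈ Finset.range (m + 3), (circEulerian (m + 2) l : ℂ) * q ^ l := by
  rw [eulP_eq, Polynomial.eval_map, Polynomial.eval₂_eq_sum_range' (n := m + 3)]
  · simp [circEulerian_eq_coeff]
  · rw [Nat.lt_succ_iff, Polynomial.natDegree_le_iff_coeff_eq_zero]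
    intro l hl
    rw [← circEulerian_eq_coeff]
    exact circEulerian_top m l hl

/-- paired terms of the partial fraction expansion -/
noncomputable def gT (k n : ℕ) (z : ℂ) : ℂ :=
  1 / (z - (n + 1)) ^ k + 1 / (z + (n + 1)) ^ k

noncomputable def hS (k : ℕ) (z : ℂ) : ℂ := 1 / z ^ k + ∑' n : ℕ, gT k n z

/-- the disc with diameter `(0, 1/2)` -/
def disc : Set ℂ := Metric.ball (1 / 4 : ℂ) (1 / 4)

lemma disc_norm {z : ℂ} (hz : z ∈ disc) : ‖z‖ ≤ 1 / 2 := by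
  have h : ‖z - 1 / 4‖ < 1 / 4 := by simpa [disc, dist_eq_norm] using hz
  calc ‖z‖ = ‖(z - 1 / 4) + 1 / 4‖ := by ring_nf
    _ ≤ ‖z - 1 / 4‖ + ‖(1 / 4 : ℂ)‖ := norm_add_le _ _
    _ ≤ 1 / 4 + 1 / 4 := by
      gcongr
      norm_num
    _ = 1 / 2 := by norm_num

lemma disc_re {z : ℂ} (hz : z ∈ disc) : 0 < z.re ∧ z.re < 1 / 2 := by
  have h : ‖z - 1 / 4‖ < 1 / 4 := by simpa [disc, dist_eq_norm] using hz
  have h2 := (Complex.abs_re_le_norm (z - 1 / 4)).trans_lt h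
  rw [abs_lt] at h2
  have h3 : (z - 1 / 4).re = z.re - 1 / 4 := by
    rw [Complex.sub_re]; congr 1; norm_num
  rw [h3] at h2
  constructor <;> linarith [h2.1, h2.2]

lemma disc_intCompl {z : ℂ} (hz : z ∈ disc) : z ∈ Complex.integerComplement := by
  rintro ⟨m, rfl⟩
  have := disc_re hz
  simp only [Complex.intCast_re] at this
  have h1 : (0 : ℤ) < m := by exact_mod_cast this.1
  have h2 : (m : ℝ) < 1 := by linarith [this.2]
  have h3 : m < 1 := by exact_mod_cast h2
  omega

lemma disc_ne_zero {z : ℂ} (hz : z ∈ disc) : z ≠ 0 := by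
  rintro rfl
  have := (disc_re hz).1
  simp at this

lemma disc_sub_ge {z : ℂ} (hz : z ∈ disc) (n : ℕ) : ((n : ℝ) + 1) / 2 ≤ ‖z - (n + 1)‖ := by
  have h := disc_norm hz
  have h1 : ‖((n : ℂ) + 1)‖ = n + 1 := by
    rw [show ((n : ℂ) + 1) = ((n + 1 : ℕ) : ℂ) by push_cast; rfl, Complex.norm_natCast]
    push_cast; rfl
  have h2 := norm_sub_norm_le ((n : ℂ) + 1) z
  rw [norm_sub_rev] at h2
  have : (0 : ℝ) ≤ n := Nat.cast_nonneg n
  linarith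

lemma disc_add_ge {z : ℂ} (hz : z ∈ disc) (n : ℕ) : ((n : ℝ) + 1) / 2 ≤ ‖z + (n + 1)‖ := by
  have h := disc_norm hz
  have h1 : ‖((n : ℂ) + 1)‖ = n + 1 := by
    rw [show ((n : ℂ) + 1) = ((n + 1 : ℕ) : ℂ) by push_cast; rfl, Complex.norm_natCast]
    push_cast; rfl
  have h2 := norm_sub_norm_le ((n : ℂ) + 1) (-z)
  rw [norm_neg, sub_neg_eq_add, add_comm _ z] at h2
  have : (0 : ℝ) ≤ n := Nat.cast_nonneg n
  linarith

lemma disc_sub_ne {z : ℂ} (hz : z ∈ disc) (n : ℕ) : z - (n + 1) ≠ 0 := by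
  have h := disc_sub_ge hz n
  intro h0
  rw [h0, norm_zero] at h
  have : (0 : ℝ) ≤ n := Nat.cast_nonneg n
  linarith

lemma disc_add_ne {z : ℂ} (hz : z ∈ disc) (n : ℕ) : z + (n + 1) ≠ 0 := by
  have h := disc_add_ge hz n
  intro h0
  rw [h0, norm_zero] at h
  have : (0 : ℝ) ≤ n := Nat.cast_nonneg n
  linarith

lemma gT_bound {z : ℂ} (hz : z ∈ disc) (k n : ℕ) :
    ‖gT k n z‖ ≤ 2 ^ (k + 1) * (1 / ((n : ℝ) + 1) ^ k) := by
  have h0 : (0 : ℝ) < ((n : ℝ) + 1) / 2 := by positivity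
  unfold gT
  calc _ ≤ ‖1 / (z - (n + 1)) ^ k‖ + ‖1 / (z + (n + 1)) ^ k‖ := norm_add_le _ _
    _ = 1 / ‖z - (n + 1)‖ ^ k + 1 / ‖z + (n + 1)‖ ^ k := by simp
    _ ≤ 1 / (((n : ℝ) + 1) / 2) ^ k + 1 / (((n : ℝ) + 1) / 2) ^ k := by
      gcongr
      · exact disc_sub_ge hz n
      · exact disc_add_ge hz n
    _ = _ := by
      rw [div_pow, pow_succ]
      field_simp
      ring

lemma summable_bound (k : ℕ) (hk : 2 ≤ k) :
    Summable (fun n : ℕ => 2 ^ (k + 1) * (1 / ((n : ℝ) + 1) ^ k)) := by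
  apply Summable.mul_left
  have := (summable_nat_add_iff 1).mpr (Real.summable_one_div_nat_pow.mpr (show 1 < k by omega))
  simpa using this

lemma summable_gT {z : ℂ} (hz : z ∈ disc) (k : ℕ) : Summable (fun n => gT (k + 1) n z) := by
  rcases k with _ | k
  · have := summable_cotTerm (disc_intCompl hz)
    simpa [gT, cotTerm] using this
  · exact Summable.of_norm_bounded (summable_bound (k + 2) (by omega)) (fun n => gT_bound hz _ n)

lemma hasDerivAt_one_div_pow (k : ℕ) (a z : ℂ) (h : z + a ≠ 0) :
    HasDerivAt (fun w : ℂ => 1 / (w + a) ^ (k + 1))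
      (-((k : ℂ) + 1) * (1 / (z + a) ^ (k + 2))) z := by
  have h1 : HasDerivAt (fun w : ℂ => (w + a) ^ (k + 1))
      (((k + 1 : ℕ) : ℂ) * (z + a) ^ k * 1) z := by
    exact ((hasDerivAt_id z).add_const a).fun_pow (k + 1)
  have h2 := h1.fun_inv (pow_ne_zero _ h)
  simp only [one_div]
  refine h2.congr_deriv ?_
  push_cast
  field_simp
  ring

lemma hasDerivAt_gT {z : ℂ} (hz : z ∈ disc) (k n : ℕ) :
    HasDerivAt (gT (k + 1) n) (-((k : ℂ) + 1) * gT (k + 2) n z) z := by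
  have h1 := hasDerivAt_one_div_pow k (-((n : ℂ) + 1)) z
    (by simpa [sub_eq_add_neg] using disc_sub_ne hz n)
  have h2 := hasDerivAt_one_div_pow k ((n : ℂ) + 1) z (disc_add_ne hz n)
  have h3 := h1.fun_add h2
  have e1 : gT (k + 1) n = fun w : ℂ => 1 / (w + -((n : ℂ) + 1)) ^ (k + 1) +
      1 / (w + ((n : ℂ) + 1)) ^ (k + 1) := by
    funext w; simp only [gT, sub_eq_add_neg]
  rw [e1]
  refine h3.congr_deriv ?_
  simp only [gT, sub_eq_add_neg]
  ring

lemma hasDerivAt_hS {z : ℂ} (hz : z ∈ disc) (k : ℕ) :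
    HasDerivAt (hS (k + 1)) (-((k : ℂ) + 1) * hS (k + 2) z) z := by
  have h1 := hasDerivAt_one_div_pow k 0 z (by simpa using disc_ne_zero hz)
  have h2 := hasDerivAt_tsum_of_isPreconnected (𝕜 := ℂ)
    (g := fun n w => gT (k + 1) n w) (g' := fun n w => -((k : ℂ) + 1) * gT (k + 2) n w)
    (t := disc) (y₀ := z) (y := z)
    ((summable_bound (k + 2) (by omega)).mul_left (‖-((k : ℂ) + 1)‖)) Metric.isOpen_ball
    (convex_ball _ _).isPreconnected
    (fun n y hy => hasDerivAt_gT hy k n)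
    (fun n y hy => by
      rw [norm_mul]
      exact mul_le_mul_of_nonneg_left (gT_bound hy _ n) (norm_nonneg _))
    hz (summable_gT hz k) hz
  have h3 := h1.fun_add h2
  simp only [add_zero] at h3
  refine HasDerivAt.congr_deriv (f := hS (k + 1)) h3 ?_
  rw [tsum_mul_left]
  unfold hS
  ring

open Complex in
lemma one_sub_q_ne {z : ℂ} (hz : z ∈ disc) : 1 - Complex.exp (2 * π * I * z) ≠ 0 := by
  intro h
  have h1 : Complex.exp (2 * π * I * z) = 1 := (sub_eq_zero.mp h).symm
  rw [Complex.exp_eq_one_iff] at h1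
  obtain ⟨m, hm⟩ := h1
  apply disc_intCompl hz
  refine ⟨m, ?_⟩
  have hpi : (2 * π * I : ℂ) ≠ 0 := Complex.two_pi_I_ne_zero
  apply mul_left_cancel₀ hpi
  rw [hm]; ring

open Complex in
lemma hasDerivAt_q (z : ℂ) : HasDerivAt (fun w : ℂ => Complex.exp (2 * π * I * w))
    (2 * π * I * Complex.exp (2 * π * I * z)) z := by
  have h := ((hasDerivAt_id z).const_mul (2 * π * I : ℂ)).cexp
  simp only [mul_one, id] at h
  refine h.congr_deriv ?_
  ring

open Complex in
lemma hS_eq (k : ℕ) : ∀ z ∈ disc, hS (k + 1) z =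
    (-(2 * π * I)) ^ (k + 1) / (k.factorial : ℂ) *
      ((eulP k).eval (Complex.exp (2 * π * I * z)) / (1 - Complex.exp (2 * π * I * z)) ^ (k + 1)) := by
  induction k with
  | zero =>
    intro z hz
    have h := cot_series_rep' (disc_intCompl hz)
    have h1 : hS (0 + 1) z = π * Complex.cot (π * z) := by
      simp only [hS, gT, zero_add, pow_one]
      rw [← h]; ring
    rw [h1, Complex.cot_pi_eq_exp_ratio]
    have hq := one_sub_q_ne hz
    set q := Complex.exp (2 * π * I * z)
    have hI : (I : ℂ) ≠ 0 := I_ne_zero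
    simp only [eulP, zero_add, pow_one, Nat.factorial_zero, Nat.cast_one, div_one,
      Polynomial.eval_mul, Polynomial.eval_C, Polynomial.eval_add, Polynomial.eval_one,
      Polynomial.eval_X]
    field_simp
    linear_combination (q + 1) * I_sq
  | succ k ih =>
    intro z hz
    have hd1 := hasDerivAt_hS hz k
    have hq := one_sub_q_ne hz
    have hqd := hasDerivAt_q z
    have hp := ((eulP k).hasDerivAt (Complex.exp (2 * π * I * z))).comp z hqd
    have hden := (hqd.const_sub 1).fun_pow (k + 1)
    have hd2 := ((hp.fun_div hden (pow_ne_zero _ hq)).const_mul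
      ((-(2 * π * I)) ^ (k + 1) / (k.factorial : ℂ)))
    have hev : hS (k + 1) =ᶠ[nhds z] fun z => (-(2 * π * I)) ^ (k + 1) / (k.factorial : ℂ) *
      ((eulP k).eval (Complex.exp (2 * π * I * z)) /
        (1 - Complex.exp (2 * π * I * z)) ^ (k + 1)) := by
      filter_upwards [Metric.isOpen_ball.mem_nhds hz] with w hw using ih w hw
    have hd3 := hd2.congr_of_eventuallyEq hev
    have heq := hd1.unique hd3
    have hk : ((k : ℂ) + 1) ≠ 0 := by exact_mod_cast Nat.succ_ne_zero k
    have hf : (k.factorial : ℂ) ≠ 0 := by exact_mod_cast Nat.factorial_ne_zero k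
    have h4 : hS (k + 2) z = -(1 / ((k : ℂ) + 1)) * (-((k : ℂ) + 1) * hS (k + 2) z) := by
      field_simp
    rw [show k + 1 + 1 = k + 2 from rfl, h4, heq, eulP, Nat.factorial_succ]
    simp only [Polynomial.eval_mul, Polynomial.eval_add, Polynomial.eval_one,
      Polynomial.eval_X, Polynomial.eval_sub, Polynomial.eval_natCast, Function.comp]
    set q := Complex.exp (2 * π * I * z)
    push_cast
    generalize (eulP k).eval q = A
    generalize (Polynomial.derivative (eulP k)).eval q = B
    generalize hr : 1 - q = r at *
    rw [show k + 2 = k + 1 + 1 from rfl, pow_succ (-(2 * π * I)) (k + 1)]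
    generalize (-(2 * π * I) : ℂ) ^ (k + 1) = D
    have hr2 : r ^ (k + 1) ≠ 0 := pow_ne_zero _ hq
    have hr3 : r ^ k ≠ 0 := pow_ne_zero _ hq
    simp only [pow_succ]
    field_simp
    ring

lemma sum_even_char (N : ℕ) [NeZero N] (S : Finset (DirichletCharacter ℂ N))
    (hmem : ∀ χ, χ ∈ S ↔ χ (-1) = 1) (a : ZMod N) :
    (2 / (Nat.totient N : ℂ)) * ∑ χ ∈ S, χ a =
      (if a = 1 then 1 else 0) + (if a = -1 then 1 else 0) := by
  classical
  have hφ : (Nat.totient N : ℂ) ≠ 0 := by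
    exact_mod_cast (Nat.totient_pos.mpr (NeZero.pos N)).ne'
  have h1 : ∑ χ ∈ S, χ a = ∑ χ : DirichletCharacter ℂ N, (χ a + χ (-a)) / 2 := by
    rw [← Finset.sum_subset (Finset.subset_univ S)]
    · apply Finset.sum_congr rfl
      intro χ hχ
      rw [neg_eq_neg_one_mul, map_mul, (hmem χ).mp hχ]
      ring
    · intro χ _ hχ
      have h2 : χ (-1) = -1 := by
        have h3 : χ (-1) * χ (-1) = 1 := by rw [← map_mul]; simp
        rcases mul_self_eq_one_iff.mp h3 with h | h
        · exact absurd ((hmem χ).mpr h) hχ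
        · exact h
      rw [neg_eq_neg_one_mul, map_mul, h2]
      ring
  rw [h1, ← Finset.sum_div, Finset.sum_add_distrib, DirichletCharacter.sum_characters_eq,
    DirichletCharacter.sum_characters_eq]
  have h3 : (-a = 1) ↔ (a = -1) := neg_eq_iff_eq_neg
  simp only [h3]
  split_ifs <;> field_simp <;> ring

lemma summable_ind (N s : ℕ) (hs : 2 ≤ s) (b : ZMod N) :
    Summable (fun k : ℕ => (if (k : ZMod N) = b then (1 : ℂ) else 0) * (1 / (k : ℂ) ^ s)) := by
  refine Summable.of_norm_bounded (Real.summable_one_div_nat_pow.mpr (show 1 < s by omega)) ?_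
  intro k
  split_ifs <;> simp

lemma lfunction_side (N : ℕ) [NeZero N] (hN : 3 ≤ N) (s : ℕ) (hs : 2 ≤ s) (hev : Even s)
    (S : Finset (DirichletCharacter ℂ N)) (hmem : ∀ χ, χ ∈ S ↔ χ (-1) = 1) :
    (2 / (Nat.totient N : ℂ)) * ∑ χ ∈ S, DirichletCharacter.LFunction χ (s : ℂ) =
      1 / (N : ℂ) ^ s * hS s (1 / (N : ℂ)) := by
  have hre : 1 < (s : ℂ).re := by
    simp only [Complex.natCast_re]
    exact_mod_cast hs
  have hs0 : s ≠ 0 := by omega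
  have hterm : ∀ (χ : DirichletCharacter ℂ N) (k : ℕ),
      LSeries.term (fun n => χ n) (s : ℂ) k = χ k * (1 / (k : ℂ) ^ s) := by
    intro χ k
    rcases Nat.eq_zero_or_pos k with rfl | hk
    · simp [hs0]
    · rw [LSeries.term_of_ne_zero hk.ne', Complex.cpow_natCast]
      ring
  have hsum : ∀ χ : DirichletCharacter ℂ N,
      Summable (fun k : ℕ => χ k * (1 / (k : ℂ) ^ s)) := by
    intro χ
    have := DirichletCharacter.LSeriesSummable_of_one_lt_re χ hre
    unfold LSeriesSummable at this
    simpa only [funext (hterm χ)] using this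
  have h1 : ∀ χ : DirichletCharacter ℂ N, DirichletCharacter.LFunction χ (s : ℂ) =
      ∑' k : ℕ, χ k * (1 / (k : ℂ) ^ s) := by
    intro χ
    rw [DirichletCharacter.LFunction_eq_LSeries χ hre]
    unfold LSeries
    exact tsum_congr (hterm χ)
  rw [Finset.sum_congr rfl (fun χ _ => h1 χ),
    ← Summable.tsum_finsetSum (fun χ _ => hsum χ), ← tsum_mul_left]
  have h2 : ∀ k : ℕ, (2 / (Nat.totient N : ℂ)) * ∑ χ ∈ S, χ k * (1 / (k : ℂ) ^ s) =
      (if (k : ZMod N) = 1 then (1 : ℂ) else 0) * (1 / (k : ℂ) ^ s) +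
      (if (k : ZMod N) = -1 then (1 : ℂ) else 0) * (1 / (k : ℂ) ^ s) := by
    intro k
    rw [← Finset.sum_mul, ← mul_assoc, sum_even_char N S hmem, add_mul]
  rw [tsum_congr h2, Summable.tsum_add (summable_ind N s hs 1) (summable_ind N s hs (-1))]
  have hN0 : (N : ℂ) ≠ 0 := by exact_mod_cast (NeZero.ne N)
  -- residue class 1
  have hinj1 : Function.Injective (fun n : ℕ => n * N + 1) := by
    intro a b h
    simp only [add_left_inj] at h
    exact Nat.eq_of_mul_eq_mul_right (NeZero.pos N) h
  have hinj2 : Function.Injective (fun n : ℕ => n * N + (N - 1)) := by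
    intro a b h
    simp only [add_left_inj] at h
    exact Nat.eq_of_mul_eq_mul_right (NeZero.pos N) h
  have hsupp1 : Function.support (fun k : ℕ => (if (k : ZMod N) = 1 then (1 : ℂ) else 0) *
      (1 / (k : ℂ) ^ s)) ⊆ Set.range (fun n : ℕ => n * N + 1) := by
    intro k hk
    have hk1 : (k : ZMod N) = 1 := by
      by_contra h
      simp [h] at hk
    have hk2 : (k : ZMod N) = ((1 : ℕ) : ZMod N) := by simpa using hk1
    rw [ZMod.natCast_eq_natCast_iff'] at hk2
    rw [Nat.mod_eq_of_lt (show 1 < N by omega)] at hk2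
    exact ⟨k / N, by have := Nat.div_add_mod k N; rw [hk2, mul_comm] at this; exact this⟩
  have hcast : (((N - 1 : ℕ)) : ZMod N) = -1 := by
    rw [Nat.cast_sub (by omega)]; simp
  have hsupp2 : Function.support (fun k : ℕ => (if (k : ZMod N) = -1 then (1 : ℂ) else 0) *
      (1 / (k : ℂ) ^ s)) ⊆ Set.range (fun n : ℕ => n * N + (N - 1)) := by
    intro k hk
    have hk1 : (k : ZMod N) = -1 := by
      by_contra h
      simp [h] at hk
    rw [← hcast, ZMod.natCast_eq_natCast_iff'] at hk1
    rw [Nat.mod_eq_of_lt (show N - 1 < N by omega)] at hk1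
    exact ⟨k / N, by have := Nat.div_add_mod k N; rw [hk1, mul_comm] at this; exact this⟩
  rw [← hinj1.tsum_eq hsupp1, ← hinj2.tsum_eq hsupp2]
  have hs1 : Summable (fun n : ℕ => (if ((n * N + 1 : ℕ) : ZMod N) = 1 then (1 : ℂ) else 0) *
      (1 / ((n * N + 1 : ℕ) : ℂ) ^ s)) := (summable_ind N s hs 1).comp_injective hinj1
  have hs2 : Summable (fun n : ℕ =>
      (if ((n * N + (N - 1) : ℕ) : ZMod N) = -1 then (1 : ℂ) else 0) *
      (1 / ((n * N + (N - 1) : ℕ) : ℂ) ^ s)) := (summable_ind N s hs (-1)).comp_injective hinj2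
  rw [hs1.tsum_eq_zero_add]
  have hs1' := (summable_nat_add_iff 1).mpr hs1
  rw [add_assoc, ← Summable.tsum_add hs1' hs2]
  unfold hS
  rw [mul_add, ← tsum_mul_left]
  congr 1
  · simp [hN0]
  · apply tsum_congr
    intro n
    have e1 : (((n + 1) * N + 1 : ℕ) : ZMod N) = 1 := by simp
    have e2 : ((n * N + (N - 1) : ℕ) : ZMod N) = -1 := by
      rw [Nat.cast_add, hcast]; simp
    rw [if_pos e1, if_pos e2, one_mul, one_mul]
    unfold gT
    have f1 : (((n + 1) * N + 1 : ℕ) : ℂ) = N * (1 / (N : ℂ) + (n + 1)) := by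
      push_cast; field_simp; ring
    have f2 : ((n * N + (N - 1) : ℕ) : ℂ) = -(N * (1 / (N : ℂ) - (n + 1))) := by
      rw [Nat.cast_add, Nat.cast_sub (by omega)]
      push_cast; field_simp; ring
    rw [f1, f2, hev.neg_pow, mul_pow, mul_pow]
    simp only [one_div, mul_inv]
    ring

/-- auxiliary alternating binomial sum -/
noncomputable def uS (M k : ℕ) (y : ℝ) : ℝ :=
  ∑ i ∈ Finset.range M, (-4 * y) ^ i * (Nat.choose (k + i) (2 * i) : ℝ)

lemma uS_rec (M k : ℕ) (y : ℝ) (hM : k + 1 < M) :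
    uS (M + 1) (k + 2) y + uS (M + 1) k y = 2 * (1 - 2 * y) * uS (M + 1) (k + 1) y := by
  have hb : ∀ i : ℕ, (Nat.choose (k + 2 + (i + 1)) (2 * (i + 1)) : ℝ) +
      Nat.choose (k + (i + 1)) (2 * (i + 1)) =
      2 * Nat.choose (k + 1 + (i + 1)) (2 * (i + 1)) + Nat.choose (k + 1 + i) (2 * i) := by
    intro i
    have e1 : Nat.choose (k + 2 + (i + 1)) (2 * (i + 1)) =
        Nat.choose (k + i + 2) (2 * i + 1) + Nat.choose (k + i + 2) (2 * i + 2) := by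
      rw [show k + 2 + (i + 1) = (k + i + 2) + 1 by ring, show 2 * (i + 1) = 2 * i + 1 + 1 by ring,
        Nat.choose_succ_succ]
    have e2 : Nat.choose (k + i + 2) (2 * i + 2) =
        Nat.choose (k + i + 1) (2 * i + 1) + Nat.choose (k + i + 1) (2 * i + 2) := by
      rw [Nat.choose_succ_succ]
    have e3 : Nat.choose (k + i + 2) (2 * i + 1) =
        Nat.choose (k + i + 1) (2 * i) + Nat.choose (k + i + 1) (2 * i + 1) := by
      rw [Nat.choose_succ_succ]
    rw [show k + (i + 1) = k + i + 1 by ring, show k + 1 + (i + 1) = k + i + 2 by ring,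
      show k + 1 + i = k + i + 1 by ring, e1, show 2 * (i + 1) = 2 * i + 2 by ring, e3, e2]
    push_cast
    ring
  have hlast : uS (M + 1) (k + 1) y = uS M (k + 1) y := by
    unfold uS
    rw [Finset.sum_range_succ, Nat.choose_eq_zero_of_lt (by omega)]
    simp
  have h4 : 2 * (1 - 2 * y) * uS (M + 1) (k + 1) y =
      2 * uS (M + 1) (k + 1) y + (-4 * y) * uS M (k + 1) y := by
    rw [← hlast]; ring
  rw [h4]
  unfold uS
  rw [Finset.sum_range_succ', Finset.sum_range_succ' _ M, Finset.sum_range_succ' _ M]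
  simp only [pow_zero, Nat.mul_zero, Nat.choose_zero_right, Nat.cast_one, mul_one]
  have h5 : (∑ i ∈ range M, (-4 * y) ^ (i + 1) * ((k + 2 + (i + 1)).choose (2 * (i + 1)) : ℝ)) +
      ∑ i ∈ range M, (-4 * y) ^ (i + 1) * ((k + (i + 1)).choose (2 * (i + 1)) : ℝ) =
      2 * (∑ i ∈ range M, (-4 * y) ^ (i + 1) * ((k + 1 + (i + 1)).choose (2 * (i + 1)) : ℝ)) +
      (-4 * y) * ∑ i ∈ range M, (-4 * y) ^ i * ((k + 1 + i).choose (2 * i) : ℝ) := by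
    rw [← Finset.sum_add_distrib, Finset.mul_sum, Finset.mul_sum, ← Finset.sum_add_distrib]
    apply Finset.sum_congr rfl
    intro i _
    linear_combination (-4 * y) ^ (i + 1) * hb i
  linear_combination h5

lemma uS_cos (θ : ℝ) (M : ℕ) (k : ℕ) (hM : k + 3 < M) :
    uS (M + 1) (k + 1) (Real.sin θ ^ 2) + uS (M + 1) k (Real.sin θ ^ 2) =
      2 * Real.cos (2 * (k + 1) * θ) := by
  have hsmall : ∀ k, k < M → uS (M + 1) k (Real.sin θ ^ 2) = uS (k + 1) k (Real.sin θ ^ 2) := by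
    intro k hk
    unfold uS
    symm
    apply Finset.sum_subset
    · intro i; simp only [Finset.mem_range]; omega
    · intro i _ hi
      simp only [Finset.mem_range] at hi
      rw [Nat.choose_eq_zero_of_lt (by omega)]
      simp
  have c2 : Real.cos (2 * θ) = 1 - 2 * Real.sin θ ^ 2 := by
    rw [Real.cos_two_mul, Real.cos_sq']; ring
  induction k using Nat.strong_induction_on with
  | _ k ih =>
    match k with
    | 0 =>
      rw [hsmall 1 (by omega), hsmall 0 (by omega)]
      have : (2 * ((0 : ℕ) + 1) * θ : ℝ) = 2 * θ := by push_cast; ring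
      rw [this, c2]
      simp [uS, Finset.sum_range_succ]
      ring
    | 1 =>
      rw [hsmall 2 (by omega), hsmall 1 (by omega)]
      have : (2 * ((1 : ℕ) + 1) * θ : ℝ) = 2 * (2 * θ) := by push_cast; ring
      rw [this, Real.cos_two_mul, c2]
      simp [uS, Finset.sum_range_succ, Nat.choose]
      ring
    | k + 2 =>
      have i0 := ih k (by omega) (by omega)
      have i1 := ih (k + 1) (by omega) (by omega)
      have r0 := uS_rec M k (Real.sin θ ^ 2) (by omega)
      have r1 := uS_rec M (k + 1) (Real.sin θ ^ 2) (by omega)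
      have hc : Real.cos (2 * ((k + 2 : ℕ) + 1) * θ) + Real.cos (2 * (k + 1) * θ) =
          2 * (1 - 2 * Real.sin θ ^ 2) * Real.cos (2 * ((k + 1 : ℕ) + 1) * θ) := by
        rw [← c2]
        have a1 : (2 * ((k + 2 : ℕ) + 1) * θ : ℝ) = 2 * ((k + 1 : ℕ) + 1) * θ + 2 * θ := by
          push_cast; ring
        have a2 : (2 * (k + 1) * θ : ℝ) = 2 * ((k + 1 : ℕ) + 1) * θ - 2 * θ := by
          push_cast; ring
        rw [a1, a2, Real.cos_add, Real.cos_sub]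
        ring
      simp only [show k + 1 + 2 = k + 2 + 1 from rfl, show k + 1 + 1 = k + 2 from rfl] at *
      linear_combination r0 + r1 - i0 - 2 * hc + 2 * (1 - 2 * Real.sin θ ^ 2) * i1

lemma tCoeff_eq (k i : ℕ) (hi : i ≤ k + 1) : (-1) ^ (k + 1) * tCoeff (k + 1) i =
    (-4) ^ i * ((Nat.choose (k + 1 + i) (2 * i) : ℝ) + Nat.choose (k + i) (2 * i)) / 2 := by
  unfold tCoeff
  rw [if_neg (by omega)]
  have hsym : Nat.choose (k + 1 + i) (k + 1 - i) = Nat.choose (k + 1 + i) (2 * i) := by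
    rw [← Nat.choose_symm (by omega : 2 * i ≤ k + 1 + i)]
    congr 1; omega
  rw [hsym]
  have hsgn : (-1 : ℝ) ^ (k + 1) * ((-1) ^ (k + 1 - i) * 2 ^ (2 * i)) = (-4) ^ i := by
    rw [← mul_assoc, ← pow_add, show k + 1 + (k + 1 - i) = 2 * (k + 1 - i) + i by omega,
      pow_add, pow_mul, pow_mul, show (-4 : ℝ) = -1 * 2 ^ 2 by norm_num, mul_pow]
    norm_num
  have hmain : ((k + 1 : ℕ) : ℝ) / (((k + 1 : ℕ) : ℝ) + i) * (Nat.choose (k + 1 + i) (2 * i) : ℝ)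
      = ((Nat.choose (k + 1 + i) (2 * i) : ℝ) + Nat.choose (k + i) (2 * i)) / 2 := by
    have hpos : ((k + 1 : ℕ) : ℝ) + i ≠ 0 := by positivity
    have h := Nat.choose_mul_succ_eq (k + i) (2 * i)
    rw [show k + i + 1 = k + 1 + i by ring] at h
    have h' : (Nat.choose (k + i) (2 * i) : ℝ) * (k + 1 + i) =
        Nat.choose (k + 1 + i) (2 * i) * ((k + 1 : ℝ) - i) := by
      have := congrArg (Nat.cast : ℕ → ℝ) h
      push_cast [show 2 * i ≤ k + 1 + i by omega] at this
      linear_combination this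
    push_cast at hpos ⊢
    field_simp
    linear_combination -h'
  calc _ = ((-1 : ℝ) ^ (k + 1) * ((-1) ^ (k + 1 - i) * 2 ^ (2 * i))) *
      (((k + 1 : ℕ) : ℝ) / (((k + 1 : ℕ) : ℝ) + i) * (Nat.choose (k + 1 + i) (2 * i) : ℝ)) := by
        ring
    _ = _ := by rw [hsgn, hmain]; ring

lemma tCoeff_cos (k : ℕ) (θ : ℝ) :
    (-1) ^ (k + 1) * ∑ i ∈ Finset.range (k + 2), tCoeff (k + 1) i * Real.sin θ ^ (2 * i) =
      Real.cos (2 * (k + 1) * θ) := by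
  have h := uS_cos θ (k + 4) k (by omega)
  have hsmall : ∀ j, j ≤ k + 1 →
      uS (k + 4 + 1) j (Real.sin θ ^ 2) = uS (k + 2) j (Real.sin θ ^ 2) := by
    intro j hj
    unfold uS
    symm
    apply Finset.sum_subset
    · intro i; simp only [Finset.mem_range]; omega
    · intro i _ hi
      simp only [Finset.mem_range] at hi
      rw [Nat.choose_eq_zero_of_lt (by omega)]
      simp
  rw [hsmall _ le_rfl, hsmall k (by omega)] at h
  have : (-1) ^ (k + 1) * ∑ i ∈ Finset.range (k + 2), tCoeff (k + 1) i * Real.sin θ ^ (2 * i) =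
      (uS (k + 2) (k + 1) (Real.sin θ ^ 2) + uS (k + 2) k (Real.sin θ ^ 2)) / 2 := by
    unfold uS
    rw [← Finset.sum_add_distrib, Finset.mul_sum, Finset.sum_div]
    apply Finset.sum_congr rfl
    intro i hi
    rw [← mul_assoc, tCoeff_eq k i (by simp only [Finset.mem_range] at hi; omega), mul_pow, pow_mul]
    ring
  rw [this, h]; ring

/-- `cos (2kθ)`, halved at `k = 0`. -/
noncomputable def vC (θ : ℝ) (k : ℕ) : ℝ := if k = 0 then 1 / 2 else Real.cos (2 * k * θ)

lemma tCoeff_vC (k : ℕ) (θ : ℝ) :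
    (-1) ^ k * ∑ i ∈ Finset.range (k + 1), tCoeff k i * Real.sin θ ^ (2 * i) = vC θ k := by
  rcases k with _ | k
  · simp [tCoeff, vC]
  · have := tCoeff_cos k θ
    rw [show k + 1 + 1 = k + 2 from rfl, this]
    simp [vC]

lemma rhs_sum (n : ℕ) (θ : ℝ) (hs : Real.sin θ ≠ 0) :
    ∑ i ∈ Finset.Icc 1 n, aCoeff n i / Real.sin θ ^ (2 * i) =
      (∑ l ∈ Finset.Icc 1 n, 2 * (circEulerian (2 * n) l : ℝ) * vC θ (n - l)) /
        Real.sin θ ^ (2 * n) := by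
  unfold aCoeff
  have h1 : ∀ i ∈ Finset.Icc 1 n, (2 * ∑ l ∈ Finset.Icc 1 i, (-1) ^ (n - l) *
      tCoeff (n - l) (n - i) * (circEulerian (2 * n) l : ℝ)) / Real.sin θ ^ (2 * i) =
      ∑ l ∈ Finset.Icc 1 i, 2 * (circEulerian (2 * n) l : ℝ) * ((-1) ^ (n - l) *
        (tCoeff (n - l) (n - i) * Real.sin θ ^ (2 * (n - i)))) / Real.sin θ ^ (2 * n) := by
    intro i hi
    rw [Finset.mem_Icc] at hi
    rw [Finset.mul_sum, Finset.sum_div]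
    apply Finset.sum_congr rfl
    intro l _
    have e : Real.sin θ ^ (2 * n) = Real.sin θ ^ (2 * (n - i)) * Real.sin θ ^ (2 * i) := by
      rw [← pow_add]; congr 1; omega
    rw [e]
    field_simp
  rw [Finset.sum_congr rfl h1, Finset.sum_div]
  rw [Finset.sum_comm' (t' := Finset.Icc 1 n) (s' := fun l => Finset.Icc l n)]
  · apply Finset.sum_congr rfl
    intro l hl
    rw [Finset.mem_Icc] at hl
    rw [← Finset.sum_div, ← Finset.mul_sum, ← Finset.mul_sum, ← tCoeff_vC]
    congr 3
    refine Finset.sum_bij' (fun i _ => n - i) (fun j _ => n - j) ?_ ?_ ?_ ?_ ?_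
    · intro i hi; simp only [Finset.mem_Icc, Finset.mem_range] at *; omega
    · intro i hi; simp only [Finset.mem_Icc, Finset.mem_range] at *; omega
    · intro i hi; simp only [Finset.mem_Icc] at *; omega
    · intro i hi; simp only [Finset.mem_range] at *; omega
    · intro i hi; rfl
  · intro x y
    simp only [Finset.mem_Icc]
    omega

open Complex in
lemma eul_sum (m : ℕ) (θ : ℝ) (q : ℂ) (hq : q = Complex.exp (2 * θ * I)) :
    ∑ l ∈ Finset.range (2 * m + 3), (circEulerian (2 * m + 2) l : ℂ) * q ^ l =
      q ^ (m + 1) * ((∑ l ∈ Finset.Icc 1 (m + 1),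
        2 * (circEulerian (2 * m + 2) l : ℝ) * vC θ (m + 1 - l) : ℝ) : ℂ) := by
  have hq0 : q ≠ 0 := by rw [hq]; exact Complex.exp_ne_zero _
  have hsub : ∑ l ∈ Finset.Icc 1 (m + 1),
        2 * (circEulerian (2 * m + 2) l : ℝ) * vC θ (m + 1 - l) =
      ∑ l ∈ Finset.range (m + 2), 2 * (circEulerian (2 * m + 2) l : ℝ) * vC θ (m + 1 - l) := by
    apply Finset.sum_subset
    · intro i; simp only [Finset.mem_Icc, Finset.mem_range]; omega
    · intro i hi hi2
      simp only [Finset.mem_Icc, Finset.mem_range] at hi hi2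
      have : i = 0 := by omega
      rw [this, circEulerian_zero]
      simp
  rw [hsub, Finset.sum_range_succ _ (m + 1), show 2 * m + 3 = (m + 1) + (m + 1 + 1) by ring,
    Finset.sum_range_add, Finset.sum_range_succ' _ (m + 1),
    ← Finset.sum_range_reflect (n := m + 1)
      (fun x => (circEulerian (2 * m + 2) (m + 1 + (x + 1)) : ℂ) * q ^ (m + 1 + (x + 1))),
    ← add_assoc, ← Finset.sum_add_distrib]
  push_cast
  rw [mul_add, Finset.mul_sum]
  congr 1
  · apply Finset.sum_congr rfl
    intro l hl
    rw [Finset.mem_range] at hl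
    obtain ⟨k, hk⟩ : ∃ k, m + 1 = l + (k + 1) := ⟨m - l, by omega⟩
    have e1 : m + 1 + (m - l + 1) = 2 * m + 2 - l := by omega
    rw [e1, circEulerian_symm (2 * m) l (by omega)]
    have e2 : 2 * m + 2 - l = l + (k + 1) + (k + 1) := by omega
    have e3 : m + 1 - l = k + 1 := by omega
    rw [e2, e3, hk]
    have hv : ((vC θ (k + 1) : ℝ) : ℂ) = (q ^ (k + 1) + (q ^ (k + 1))⁻¹) / 2 := by
      unfold vC
      rw [if_neg (by omega), Complex.ofReal_cos, Complex.cos, hq, ← Complex.exp_nat_mul,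
        ← Complex.exp_neg]
      congr 3
      · push_cast; ring
      · push_cast; ring
    rw [hv]
    simp only [pow_add q l, pow_add q (l + (k + 1))]
    have := pow_ne_zero (k + 1) hq0
    generalize q ^ (k + 1) = Q at *
    field_simp
    ring
  · simp [vC]
    ring

lemma one_div_mem_disc (N : ℕ) (hN : 3 ≤ N) : (1 / (N : ℂ)) ∈ disc := by
  have h3 : (3 : ℝ) ≤ N := by exact_mod_cast hN
  have : (1 / (N : ℂ)) - 1 / 4 = ((1 / (N : ℝ) - 1 / 4 : ℝ) : ℂ) := by push_cast; rfl
  rw [disc, Metric.mem_ball, dist_eq_norm, this, Complex.norm_real, Real.norm_eq_abs, abs_lt]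
  have h1 : 0 < 1 / (N : ℝ) := by positivity
  have h2 : 1 / (N : ℝ) ≤ 1 / 3 := by gcongr
  constructor <;> linarith

open Complex in
lemma one_sub_q_sq (θ : ℝ) (q : ℂ) (hq : q = Complex.exp (2 * θ * I)) :
    (1 - q) ^ 2 = -4 * q * ((Real.sin θ : ℝ) : ℂ) ^ 2 := by
  rw [Complex.ofReal_sin, Complex.sin]
  have h1 : q = Complex.exp (θ * I) ^ 2 := by
    rw [hq, ← Complex.exp_nat_mul]; congr 1; push_cast; ring
  have h2 : Complex.exp (-θ * I) = (Complex.exp (θ * I))⁻¹ := by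
    rw [← Complex.exp_neg]; congr 1; ring
  rw [h1, h2]
  have := Complex.exp_ne_zero (θ * I)
  generalize Complex.exp (θ * I) = w at *
  have hI := I_sq
  field_simp
  linear_combination (w ^ 2 - 1) ^ 2 * 4 * hI

open scoped Classical in
/-- For `N ≥ 3` and `n ≥ 1`, the average of even-character `L`-values:
`(2/φ(N)) ∑_{χ even mod N} L(2n,χ) = (π^{2n}/((2n-1)! N^{2n})) ∑_{i=1}^{n} a_{n,i}/sin^{2i}(π/N)`. -/
theorem average_even_LFunction (N : ℕ) [NeZero N] (hN : 3 ≤ N) (n : ℕ) (hn : 1 ≤ n) :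
    (2 / (Nat.totient N : ℂ)) *
        ∑ χ ∈ Finset.univ.filter (fun χ : DirichletCharacter ℂ N => χ (-1) = 1),
          DirichletCharacter.LFunction χ ((2 * n : ℕ) : ℂ) =
      ((π : ℂ) ^ (2 * n) / ((Nat.factorial (2 * n - 1) : ℂ) * (N : ℂ) ^ (2 * n))) *
        ∑ i ∈ Finset.Icc 1 n, (aCoeff n i : ℂ) / ((Real.sin (π / N) : ℂ)) ^ (2 * i) := by

  rw [lfunction_side N hN (2 * n) (by omega) (by simp) _ (by simp)]
  obtain ⟨m, rfl⟩ : ∃ m, n = m + 1 := ⟨n - 1, by omega⟩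
  have hz := one_div_mem_disc N hN
  have h3 : (3 : ℝ) ≤ N := by exact_mod_cast hN
  have hN0 : (N : ℂ) ≠ 0 := by exact_mod_cast (NeZero.ne N)
  have hsin : Real.sin (π / N) ≠ 0 := by
    apply ne_of_gt
    apply Real.sin_pos_of_pos_of_lt_pi
    · positivity
    · rw [div_lt_iff₀ (by linarith)]
      nlinarith [Real.pi_pos]
  have hr := congrArg (Complex.ofReal) (rhs_sum (m + 1) (π / N) hsin)
  rw [Complex.ofReal_sum] at hr
  simp only [Complex.ofReal_div, Complex.ofReal_pow] at hr
  rw [hr]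
  have hh := hS_eq (2 * m + 1) _ hz
  rw [show 2 * (m + 1) = 2 * m + 1 + 1 by ring, hh, eulP_eval]
  have hq : Complex.exp (2 * π * Complex.I * (1 / (N : ℂ))) =
      Complex.exp (2 * ((π / N : ℝ) : ℂ) * Complex.I) := by
    congr 1; push_cast; ring
  rw [eul_sum m (π / N) _ hq]
  have hsq := one_sub_q_sq (π / N) _ hq
  have hqne := Complex.exp_ne_zero (2 * π * Complex.I * (1 / (N : ℂ)))
  set q := Complex.exp (2 * π * Complex.I * (1 / (N : ℂ)))
  rw [show 2 * m + 1 + 1 = 2 * (m + 1) by ring, show 2 * (m + 1) - 1 = 2 * m + 1 by omega]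
  set Sg := ((∑ l ∈ Finset.Icc 1 (m + 1),
        2 * (circEulerian (2 * (m + 1)) l : ℝ) * vC (π / N) (m + 1 - l) : ℝ) : ℂ)
  rw [pow_mul (1 - q), hsq, pow_mul (-(2 * (π : ℂ) * Complex.I)),
    show (-(2 * (π : ℂ) * Complex.I)) ^ 2 = -4 * (π : ℂ) ^ 2 by
      linear_combination 4 * (π : ℂ) ^ 2 * Complex.I_sq]
  have hsC : ((Real.sin (π / N) : ℝ) : ℂ) ≠ 0 := by exact_mod_cast hsin
  have hf : ((2 * m + 1).factorial : ℂ) ≠ 0 := by exact_mod_cast Nat.factorial_ne_zero _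
  generalize ((Real.sin (π / N) : ℝ) : ℂ) = s at *
  have h4 : (-4 : ℂ) ^ (m + 1) ≠ 0 := pow_ne_zero _ (by norm_num)
  simp only [mul_pow, pow_mul]
  generalize (-4 : ℂ) ^ (m + 1) = D at *
  field_simp
end
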